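/- Let Ω ⊂ ℝ be an open bounded interval, let f satisfy hypothesis (F), and let the data satisfy the smooth-data hypothesis (I∞). Then for every T > 0 there exists C(T) > 0 such that the classical solutions (v_ε,u_ε,Θ_ε) of the regularized problems (P_ε) satisfy, for all t ∈ (0,T), all ε ∈ (0,1) and all h ∈ (0,1): ∫_Ω |v_ε(·,t+h)−v_ε(·,t)|² + ∫_Ω |u_{εx}(·,t+h)−u_{εx}(·,t)|² + ∫_Ω |Θ_ε(·,t+h)−Θ_ε(·,t)|² ≤ C(T)·{∫_Ω |v_ε(·,h)−v₀|² + ∫_Ω |u_{εx}(·,h)−u_{0x}|² + ∫_Ω |Θ_ε(·,h)−Θ₀|²}. -/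

import Mathlib

open MeasureTheory Filter Set Function

noncomputable section

/-- Integral over `Ω = (a,b)`. -/
def intOm (a b : ℝ) (g : ℝ → ℝ) : ℝ := ∫ x in Ioo a b, g x

/-- Double integral over `Ω × (0,T)`. -/
def intOmT (a b T : ℝ) (F : ℝ → ℝ → ℝ) : ℝ :=
  ∫ p in (Ioo a b) ×ˢ (Ioo 0 T), F p.1 p.2

/-- Squared `L²(Ω)` integral of `g`. -/
def sqOm (a b : ℝ) (g : ℝ → ℝ) : ℝ := ∫ x in Ioo a b, (g x) ^ 2

/-- `L²(Ω)` norm. -/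
def nrmL2 (a b : ℝ) (g : ℝ → ℝ) : ℝ := (∫ x in Ioo a b, (g x) ^ 2) ^ (1 / 2 : ℝ)

/-- `L¹(Ω)` norm. -/
def nrmL1 (a b : ℝ) (g : ℝ → ℝ) : ℝ := ∫ x in Ioo a b, |g x|

/-- Membership in `L²(Ω)`. -/
def MemL2 (a b : ℝ) (g : ℝ → ℝ) : Prop :=
  AEStronglyMeasurable g (volume.restrict (Ioo a b)) ∧
    IntegrableOn (fun x => (g x) ^ 2) (Ioo a b)

/-- Zero-trace weak derivative on `(a,b)`: `g ∈ W₀^{1,1}(a,b)` with weak derivative `g'`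
(integration by parts against all smooth test functions, with no boundary terms). -/
def WeakDerivZ (a b : ℝ) (g g' : ℝ → ℝ) : Prop :=
  ∀ ψ : ℝ → ℝ, ContDiff ℝ (⊤ : ℕ∞) ψ →
    ∫ x in Ioo a b, g x * deriv ψ x = - ∫ x in Ioo a b, g' x * ψ x

/-- Interior weak derivative on `(a,b)`: `g ∈ W^{1,1}(a,b)` with weak derivative `g'`. -/
def WeakDerivI (a b : ℝ) (g g' : ℝ → ℝ) : Prop :=
  ∀ ψ : ℝ → ℝ, ContDiff ℝ (⊤ : ℕ∞) ψ → tsupport ψ ⊆ Ioo a b →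
    ∫ x in Ioo a b, g x * deriv ψ x = - ∫ x in Ioo a b, g' x * ψ x

/-- Hypothesis (F) on the nonlinearity `f`, where `f'`, `f''` denote its first and second
derivatives on `[0,∞)`: `f ∈ C²([0,∞))`, `f(0)=0`, `f' > 0` on `[0,∞)`,
and `f' ∈ W^{1,∞}((0,∞))` (i.e. `f'` and `f''` are bounded). -/
structure HypF (f f' f'' : ℝ → ℝ) : Prop where
  hasDeriv₁ : ∀ x ∈ Ici (0 : ℝ), HasDerivWithinAt f (f' x) (Ici 0) x
  hasDeriv₂ : ∀ x ∈ Ici (0 : ℝ), HasDerivWithinAt f' (f'' x) (Ici 0) x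
  cont₂ : ContinuousOn f'' (Ici 0)
  zero : f 0 = 0
  pos : ∀ x ∈ Ici (0 : ℝ), 0 < f' x
  bdd : ∃ M : ℝ, ∀ x ∈ Ici (0 : ℝ), |f' x| ≤ M ∧ |f'' x| ≤ M

/-- Partial derivative in the first (spatial) variable. -/
def pdx (w : ℝ → ℝ → ℝ) : ℝ → ℝ → ℝ := fun x t => deriv (fun y => w y t) x

/-- Partial derivative in the second (time) variable. -/
def pdt (w : ℝ → ℝ → ℝ) : ℝ → ℝ → ℝ := fun x t => deriv (fun s => w x s) t

/-- Test functions in `C₀^∞(Ω × [0,T))`. -/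
structure TestU (a b T : ℝ) (φ : ℝ → ℝ → ℝ) : Prop where
  smooth : ContDiff ℝ (⊤ : ℕ∞) (uncurry φ)
  suppx : ∃ K : Set ℝ, IsCompact K ∧ K ⊆ Ioo a b ∧ ∀ x t, x ∉ K → φ x t = 0
  suppt : ∃ T' : ℝ, T' < T ∧ ∀ x t, T' ≤ t → φ x t = 0

/-- Test functions in `C^∞(Ω̄ × [0,T))`, compactly supported in time. -/
structure TestT (T : ℝ) (φ : ℝ → ℝ → ℝ) : Prop where
  smooth : ContDiff ℝ (⊤ : ℕ∞) (uncurry φ)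
  suppt : ∃ T' : ℝ, T' < T ∧ ∀ x t, T' ≤ t → φ x t = 0

/-- Test functions in `C₀^∞(Ω × (0,T))`. -/
structure TestInt (a b T : ℝ) (φ : ℝ → ℝ → ℝ) : Prop where
  smooth : ContDiff ℝ (⊤ : ℕ∞) (uncurry φ)
  suppx : ∃ K : Set ℝ, IsCompact K ∧ K ⊆ Ioo a b ∧ ∀ x t, x ∉ K → φ x t = 0
  supptime : ∃ K : Set ℝ, IsCompact K ∧ K ⊆ Ioo 0 T ∧ ∀ x t, t ∉ K → φ x t = 0

/-- Definition (W): weak solution of (P) on `Ω × (0,T)`.  Here `ut`, `ux`, `Θx` denote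
the weak derivatives of `u` (in time and space) and of `Θ` (in space). -/
structure IsWeakSol (a b T : ℝ) (f f' : ℝ → ℝ) (u0 u0t Θ0 : ℝ → ℝ)
    (u ut ux Θ Θx : ℝ → ℝ → ℝ) : Prop where
  u_sliceL1 : ∀ t ∈ Icc 0 T, IntegrableOn (fun x => u x t) (Ioo a b)
  u_contL1 : ∀ t₀ ∈ Icc 0 T,
    Tendsto (fun t => ∫ x in Ioo a b, |u x t - u x t₀|) (nhdsWithin t₀ (Icc 0 T)) (nhds 0)
  u_int : IntegrableOn (fun p : ℝ × ℝ => u p.1 p.2) ((Ioo a b) ×ˢ (Ioo 0 T))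
  ux_int : IntegrableOn (fun p : ℝ × ℝ => ux p.1 p.2) ((Ioo a b) ×ˢ (Ioo 0 T))
  u_W0 : ∀ᵐ t ∂volume.restrict (Ioo 0 T), WeakDerivZ a b (fun x => u x t) (fun x => ux x t)
  Θ_int : IntegrableOn (fun p : ℝ × ℝ => Θ p.1 p.2) ((Ioo a b) ×ˢ (Ioo 0 T))
  Θx_int : IntegrableOn (fun p : ℝ × ℝ => Θx p.1 p.2) ((Ioo a b) ×ˢ (Ioo 0 T))
  Θ_W : ∀ᵐ t ∂volume.restrict (Ioo 0 T), WeakDerivI a b (fun x => Θ x t) (fun x => Θx x t)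
  Θ_nonneg : ∀ᵐ p ∂volume.restrict ((Ioo a b) ×ˢ (Ioo 0 T)), 0 ≤ Θ p.1 p.2
  ut_weak : ∀ φ : ℝ → ℝ → ℝ, TestInt a b T φ →
    intOmT a b T (fun x t => u x t * pdt φ x t) = - intOmT a b T (fun x t => ut x t * φ x t)
  ut_int : IntegrableOn (fun p : ℝ × ℝ => ut p.1 p.2) ((Ioo a b) ×ˢ (Ioo 0 T))
  g1_int : IntegrableOn (fun p : ℝ × ℝ => f' (Θ p.1 p.2) * Θx p.1 p.2)
    ((Ioo a b) ×ˢ (Ioo 0 T))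
  g2_int : IntegrableOn (fun p : ℝ × ℝ => f' (Θ p.1 p.2) * Θx p.1 p.2 * ut p.1 p.2)
    ((Ioo a b) ×ˢ (Ioo 0 T))
  g3_int : IntegrableOn (fun p : ℝ × ℝ => f (Θ p.1 p.2) * ut p.1 p.2)
    ((Ioo a b) ×ˢ (Ioo 0 T))
  weak_u : ∀ φ : ℝ → ℝ → ℝ, TestU a b T φ →
    intOmT a b T (fun x t => u x t * pdt (pdt φ) x t)
        - intOm a b (fun x => u0t x * φ x 0) + intOm a b (fun x => u0 x * pdt φ x 0)
      = - intOmT a b T (fun x t => ux x t * pdx φ x t)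
        - intOmT a b T (fun x t => f' (Θ x t) * Θx x t * φ x t)
  weak_Θ : ∀ φ : ℝ → ℝ → ℝ, TestT T φ →
    - intOmT a b T (fun x t => Θ x t * pdt φ x t) - intOm a b (fun x => Θ0 x * φ x 0)
      = - intOmT a b T (fun x t => Θx x t * pdx φ x t)
        + intOmT a b T (fun x t => f' (Θ x t) * Θx x t * ut x t * φ x t)
        + intOmT a b T (fun x t => f (Θ x t) * ut x t * pdx φ x t)

/-- Continuity of `t ↦ w(·,t)` as a map `J → L²(Ω)` (with slices in `L²(Ω)`). -/
def ContL2 (a b : ℝ) (J : Set ℝ) (w : ℝ → ℝ → ℝ) : Prop :=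
  (∀ t ∈ J, MemL2 a b (fun x => w x t)) ∧
    ∀ t₀ ∈ J, Tendsto (fun t => ∫ x in Ioo a b, (w x t - w x t₀) ^ 2)
      (nhdsWithin t₀ J) (nhds 0)

/-- The regularity class (R_T):  `u ∈ C⁰([0,T];W₀^{1,2})`, `u_t ∈ C⁰([0,T];L²)`,
`Θ ∈ C⁰([0,T];L²) ∩ L²((0,T);W^{1,2})`. -/
structure RegT (a b T : ℝ) (u ut ux Θ Θx : ℝ → ℝ → ℝ) : Prop where
  u_cont : ContL2 a b (Icc 0 T) u
  ux_cont : ContL2 a b (Icc 0 T) ux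
  u_W0 : ∀ t ∈ Icc (0 : ℝ) T, WeakDerivZ a b (fun x => u x t) (fun x => ux x t)
  ut_cont : ContL2 a b (Icc 0 T) ut
  Θ_cont : ContL2 a b (Icc 0 T) Θ
  Θ_sq_int : IntegrableOn (fun p : ℝ × ℝ => (Θ p.1 p.2) ^ 2) ((Ioo a b) ×ˢ (Ioo 0 T))
  Θx_sq_int : IntegrableOn (fun p : ℝ × ℝ => (Θx p.1 p.2) ^ 2) ((Ioo a b) ×ˢ (Ioo 0 T))

/-- Data hypothesis (I), with `u0x` the weak derivative of `u0 ∈ W₀^{1,2}(Ω)`. -/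
structure DataI (a b : ℝ) (u0 u0x u0t Θ0 : ℝ → ℝ) : Prop where
  u0_L2 : MemL2 a b u0
  u0x_L2 : MemL2 a b u0x
  u0_W0 : WeakDerivZ a b u0 u0x
  u0t_L2 : MemL2 a b u0t
  Θ0_L2 : MemL2 a b Θ0
  Θ0_nonneg : ∀ᵐ x ∂volume.restrict (Ioo a b), 0 ≤ Θ0 x

/-- Smooth-data hypothesis (I∞). -/
structure SmoothData (a b : ℝ) (v0 u0 Θ0 : ℝ → ℝ) : Prop where
  v0_smooth : ContDiff ℝ (⊤ : ℕ∞) v0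
  v0_supp : ∃ K : Set ℝ, IsCompact K ∧ K ⊆ Ioo a b ∧ ∀ x, x ∉ K → v0 x = 0
  u0_smooth : ContDiff ℝ (⊤ : ℕ∞) u0
  u0_supp : ∃ K : Set ℝ, IsCompact K ∧ K ⊆ Ioo a b ∧ ∀ x, x ∉ K → u0 x = 0
  Θ0_smooth : ContDiff ℝ (⊤ : ℕ∞) Θ0
  Θ0_pos : ∀ x ∈ Icc a b, 0 < Θ0 x
  Θ0x_supp : ∃ K : Set ℝ, IsCompact K ∧ K ⊆ Ioo a b ∧ ∀ x, x ∉ K → deriv Θ0 x = 0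

/-- Classical solution of the regularized problem (P_ε), of class
`C^{4,1} × C^{2,1} × C^{2,1}(Ω̄ × [0,∞))`, with positive temperature. -/
structure IsClassicalSolEps (a b : ℝ) (f : ℝ → ℝ) (ε : ℝ) (v0 u0 Θ0 : ℝ → ℝ)
    (v u Θ : ℝ → ℝ → ℝ) : Prop where
  diffx_v : ∀ k < 4, ∀ x ∈ Icc a b, ∀ t ∈ Ici (0 : ℝ),
    DifferentiableAt ℝ (fun y => pdx^[k] v y t) x
  difft_v : ∀ x ∈ Icc a b, ∀ t ∈ Ici (0 : ℝ), DifferentiableAt ℝ (fun s => v x s) t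
  cont_v : ∀ k ≤ 4, ContinuousOn (uncurry (pdx^[k] v)) ((Icc a b) ×ˢ (Ici 0))
  contt_v : ContinuousOn (uncurry (pdt v)) ((Icc a b) ×ˢ (Ici 0))
  diffx_u : ∀ k < 2, ∀ x ∈ Icc a b, ∀ t ∈ Ici (0 : ℝ),
    DifferentiableAt ℝ (fun y => pdx^[k] u y t) x
  difft_u : ∀ x ∈ Icc a b, ∀ t ∈ Ici (0 : ℝ), DifferentiableAt ℝ (fun s => u x s) t
  cont_u : ∀ k ≤ 2, ContinuousOn (uncurry (pdx^[k] u)) ((Icc a b) ×ˢ (Ici 0))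
  contt_u : ContinuousOn (uncurry (pdt u)) ((Icc a b) ×ˢ (Ici 0))
  diffx_Θ : ∀ k < 2, ∀ x ∈ Icc a b, ∀ t ∈ Ici (0 : ℝ),
    DifferentiableAt ℝ (fun y => pdx^[k] Θ y t) x
  difft_Θ : ∀ x ∈ Icc a b, ∀ t ∈ Ici (0 : ℝ), DifferentiableAt ℝ (fun s => Θ x s) t
  cont_Θ : ∀ k ≤ 2, ContinuousOn (uncurry (pdx^[k] Θ)) ((Icc a b) ×ˢ (Ici 0))
  contt_Θ : ContinuousOn (uncurry (pdt Θ)) ((Icc a b) ×ˢ (Ici 0))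
  Θ_pos : ∀ x ∈ Icc a b, ∀ t ∈ Ici (0 : ℝ), 0 < Θ x t
  eq_v : ∀ x ∈ Ioo a b, ∀ t ∈ Ioi (0 : ℝ),
    pdt v x t = -ε * pdx^[4] v x t + pdx^[2] u x t - pdx (fun y s => f (Θ y s)) x t
  eq_u : ∀ x ∈ Ioo a b, ∀ t ∈ Ioi (0 : ℝ), pdt u x t = ε * pdx^[2] u x t + v x t
  eq_Θ : ∀ x ∈ Ioo a b, ∀ t ∈ Ioi (0 : ℝ),
    pdt Θ x t = pdx^[2] Θ x t - f (Θ x t) * pdx v x t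
  bc_v : ∀ t ∈ Ioi (0 : ℝ),
    v a t = 0 ∧ v b t = 0 ∧ pdx^[2] v a t = 0 ∧ pdx^[2] v b t = 0
  bc_u : ∀ t ∈ Ioi (0 : ℝ), u a t = 0 ∧ u b t = 0
  bc_Θ : ∀ t ∈ Ioi (0 : ℝ), pdx Θ a t = 0 ∧ pdx Θ b t = 0
  init : ∀ x ∈ Icc a b, v x 0 = v0 x ∧ u x 0 = u0 x ∧ Θ x 0 = Θ0 x

/-- Weak convergence in `L²_loc(Ω̄ × [0,∞))`. -/
def WkL2loc (a b : ℝ) (wj : ℕ → ℝ → ℝ → ℝ) (w : ℝ → ℝ → ℝ) : Prop :=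
  ∀ T > (0 : ℝ), ∀ ψ : ℝ → ℝ → ℝ,
    AEStronglyMeasurable (fun p : ℝ × ℝ => ψ p.1 p.2)
      (volume.restrict ((Icc a b) ×ˢ (Icc 0 T))) →
    IntegrableOn (fun p : ℝ × ℝ => (ψ p.1 p.2) ^ 2) ((Icc a b) ×ˢ (Icc 0 T)) →
    Tendsto (fun j => ∫ p in (Icc a b) ×ˢ (Icc 0 T), wj j p.1 p.2 * ψ p.1 p.2) atTop
      (nhds (∫ p in (Icc a b) ×ˢ (Icc 0 T), w p.1 p.2 * ψ p.1 p.2))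

theorem integral_linear_combination {a b : ℝ} (hab : a ≤ b) {g₁ g₂ g₃ g₄ g₅ : ℝ → ℝ}
    (h₁ : ContinuousOn g₁ (Icc a b)) (h₂ : ContinuousOn g₂ (Icc a b))
    (h₃ : ContinuousOn g₃ (Icc a b)) (h₄ : ContinuousOn g₄ (Icc a b))
    (h₅ : ContinuousOn g₅ (Icc a b)) (c₁ c₂ c₃ c₄ c₅ : ℝ) :
    ∫ x in a..b, (c₁ * g₁ x + c₂ * g₂ x + c₃ * g₃ x + c₄ * g₄ x + c₅ * g₅ x) =
      c₁ * (∫ x in a..b, g₁ x) + c₂ * (∫ x in a..b, g₂ x) + c₃ * (∫ x in a..b, g₃ x)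
        + c₄ * (∫ x in a..b, g₄ x) + c₅ * (∫ x in a..b, g₅ x) := by
  have i₁ := (h₁.intervalIntegrable_of_Icc hab (μ := volume)).const_mul c₁
  have i₂ := (h₂.intervalIntegrable_of_Icc hab (μ := volume)).const_mul c₂
  have i₃ := (h₃.intervalIntegrable_of_Icc hab (μ := volume)).const_mul c₃
  have i₄ := (h₄.intervalIntegrable_of_Icc hab (μ := volume)).const_mul c₄
  have i₅ := (h₅.intervalIntegrable_of_Icc hab (μ := volume)).const_mul c₅
  rw [intervalIntegral.integral_add (((i₁.add i₂).add i₃).add i₄) i₅,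
    intervalIntegral.integral_add ((i₁.add i₂).add i₃) i₄,
    intervalIntegral.integral_add (i₁.add i₂) i₃, intervalIntegral.integral_add i₁ i₂]
  simp only [intervalIntegral.integral_const_mul]

theorem integral_mono_of_continuousOn {a b : ℝ} (hab : a ≤ b) {g k : ℝ → ℝ}
    (hg : ContinuousOn g (Icc a b)) (hk : ContinuousOn k (Icc a b))
    (h : ∀ x ∈ Icc a b, g x ≤ k x) : ∫ x in a..b, g x ≤ ∫ x in a..b, k x :=
  intervalIntegral.integral_mono_on hab (hg.intervalIntegrable_of_Icc hab)
    (hk.intervalIntegrable_of_Icc hab) h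

theorem integral_eq_of_eqOn_Icc {a b : ℝ} (hab : a ≤ b) {g k : ℝ → ℝ}
    (h : ∀ x ∈ Icc a b, g x = k x) : ∫ x in a..b, g x = ∫ x in a..b, k x :=
  intervalIntegral.integral_congr fun x hx => h x (by rwa [uIcc_of_le hab] at hx)

theorem integral_sq_nonneg {a b : ℝ} (hab : a ≤ b) (g : ℝ → ℝ) :
    0 ≤ ∫ x in a..b, g x ^ 2 :=
  intervalIntegral.integral_nonneg hab fun x _ => sq_nonneg (g x)

theorem integral_mul_deriv_of_boundary {a b : ℝ} (hab : a ≤ b) {g g' k k' : ℝ → ℝ}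
    (hg : ∀ x ∈ Icc a b, HasDerivAt g (g' x) x) (hk : ∀ x ∈ Icc a b, HasDerivAt k (k' x) x)
    (cg : ContinuousOn g' (Icc a b)) (ck : ContinuousOn k' (Icc a b))
    (hb : g b * k b - g a * k a = 0) :
    ∫ x in a..b, g x * k' x = - ∫ x in a..b, g' x * k x := by
  rw [intervalIntegral.integral_mul_deriv_eq_deriv_mul (u := g) (v := k) (u' := g') (v' := k')
    (by rwa [uIcc_of_le hab]) (by rwa [uIcc_of_le hab]) (cg.intervalIntegrable_of_Icc hab)
    (ck.intervalIntegrable_of_Icc hab), hb, zero_sub]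

theorem continuousOn_of_hasDerivAt_Icc {a b : ℝ} {g g' : ℝ → ℝ}
    (hg : ∀ x ∈ Icc a b, HasDerivAt g (g' x) x) : ContinuousOn g (Icc a b) :=
  fun x hx => (hg x hx).continuousAt.continuousWithinAt

/-- One-dimensional Sobolev inequality with a free parameter. -/
theorem sq_le_integral_sq_add {a b : ℝ} (hab : a < b) {g g' : ℝ → ℝ}
    (hg : ∀ x ∈ Icc a b, HasDerivAt g (g' x) x) (cg : ContinuousOn g' (Icc a b))
    {η : ℝ} (hη : 0 < η) {x : ℝ} (hx : x ∈ Icc a b) :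
    g x ^ 2 ≤ ((b - a)⁻¹ + η⁻¹) * (∫ y in a..b, g y ^ 2) + η * ∫ y in a..b, g' y ^ 2 := by
  have hL : 0 < b - a := sub_pos.2 hab
  have c0 := continuousOn_of_hasDerivAt_Icc hg
  set J : ℝ := η⁻¹ * (∫ y in a..b, g y ^ 2) + η * ∫ y in a..b, g' y ^ 2 with hJ
  have hpt : ∀ y z : ℝ, |2 * g y * g' z| ≤ η⁻¹ * g y ^ 2 + η * g' z ^ 2 := by
    intro y z
    have h1 : η⁻¹ * g y ^ 2 + η * g' z ^ 2 - 2 * g y * g' z = η⁻¹ * (g y - η * g' z) ^ 2 := by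
      field_simp; ring
    have h2 : η⁻¹ * g y ^ 2 + η * g' z ^ 2 + 2 * g y * g' z = η⁻¹ * (g y + η * g' z) ^ 2 := by
      field_simp; ring
    have h3 : 0 ≤ η⁻¹ * (g y - η * g' z) ^ 2 := by positivity
    have h4 : 0 ≤ η⁻¹ * (g y + η * g' z) ^ 2 := by positivity
    exact abs_le.2 ⟨by linarith, by linarith⟩
  have hint : IntervalIntegrable (fun z => η⁻¹ * g z ^ 2 + η * g' z ^ 2) volume a b :=
    ContinuousOn.intervalIntegrable_of_Icc hab.le (by fun_prop)
  have hJ' : ∫ z in a..b, (η⁻¹ * g z ^ 2 + η * g' z ^ 2) = J := by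
    rw [intervalIntegral.integral_add, intervalIntegral.integral_const_mul,
      intervalIntegral.integral_const_mul]
    · exact ContinuousOn.intervalIntegrable_of_Icc hab.le (by fun_prop)
    · exact ContinuousOn.intervalIntegrable_of_Icc hab.le (by fun_prop)
  have hdiff : ∀ y ∈ Icc a b, g x ^ 2 ≤ g y ^ 2 + J := by
    intro y hy
    have hsub : uIcc y x ⊆ Icc a b := uIcc_subset_Icc hy hx
    have hFTC : ∫ z in y..x, 2 * g z * g' z = g x ^ 2 - g y ^ 2 := by
      refine intervalIntegral.integral_eq_sub_of_hasDerivAt (f := fun z => g z ^ 2) ?_ ?_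
      · intro z hz
        simpa using (hg z (hsub hz)).fun_pow 2
      · exact ContinuousOn.intervalIntegrable (ContinuousOn.mono (by fun_prop) hsub)
    have h1 : |∫ z in y..x, 2 * g z * g' z| ≤ ∫ z in a..b, (η⁻¹ * g z ^ 2 + η * g' z ^ 2) := by
      rw [← Real.norm_eq_abs, intervalIntegral.integral_of_le hab.le]
      refine (intervalIntegral.norm_integral_le_integral_norm_uIoc).trans ?_
      have hs' : uIoc y x ⊆ Ioc a b := by
        intro z hz
        rw [mem_uIoc] at hz
        rcases hz with hz | hz
        · exact ⟨hy.1.trans_lt hz.1, hz.2.trans hx.2⟩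
        · exact ⟨hx.1.trans_lt hz.1, hz.2.trans hy.2⟩
      have hI : IntegrableOn (fun z => η⁻¹ * g z ^ 2 + η * g' z ^ 2) (Ioc a b) := hint.1
      refine (setIntegral_mono_on (g := fun z => η⁻¹ * g z ^ 2 + η * g' z ^ 2) ?_ (hI.mono_set hs')
        measurableSet_uIoc fun z _ => ?_).trans
        (setIntegral_mono_set hI ?_ hs'.eventuallyLE)
      · have : ContinuousOn (fun z => ‖2 * g z * g' z‖) (Icc a b) := by fun_prop
        exact (this.integrableOn_Icc).mono_set (hs'.trans Ioc_subset_Icc_self)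
      · exact hpt z z
      · exact Eventually.of_forall fun z => by
          show (0 : ℝ) ≤ η⁻¹ * g z ^ 2 + η * g' z ^ 2
          positivity
    rw [hFTC, hJ'] at h1
    linarith [le_abs_self (g x ^ 2 - g y ^ 2)]
  have hmean : (b - a) * g x ^ 2 ≤ (∫ y in a..b, g y ^ 2) + (b - a) * J := by
    have := integral_mono_of_continuousOn hab.le (g := fun _ => g x ^ 2)
      (k := fun y => g y ^ 2 + J) continuousOn_const (by fun_prop) hdiff
    rw [intervalIntegral.integral_add, intervalIntegral.integral_const,
      intervalIntegral.integral_const] at this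
    · simpa using this
    · exact ContinuousOn.intervalIntegrable_of_Icc hab.le (by fun_prop)
    · simp
  have : g x ^ 2 ≤ (b - a)⁻¹ * ((∫ y in a..b, g y ^ 2) + (b - a) * J) := by
    rw [inv_mul_eq_div, le_div_iff₀ hL]; linarith
  refine this.trans (le_of_eq ?_)
  rw [hJ]; field_simp; ring

theorem integral_mul_fourth_deriv_nonneg {a b : ℝ} (hab : a ≤ b) {w w₁ w₂ w₃ w₄ : ℝ → ℝ}
    (h₀ : ∀ x ∈ Icc a b, HasDerivAt w (w₁ x) x) (h₁ : ∀ x ∈ Icc a b, HasDerivAt w₁ (w₂ x) x)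
    (h₂ : ∀ x ∈ Icc a b, HasDerivAt w₂ (w₃ x) x) (h₃ : ∀ x ∈ Icc a b, HasDerivAt w₃ (w₄ x) x)
    (h₄ : ContinuousOn w₄ (Icc a b)) (ha : w a = 0) (hb : w b = 0)
    (ha₂ : w₂ a = 0) (hb₂ : w₂ b = 0) : 0 ≤ ∫ x in a..b, w x * w₄ x := by
  have c₁ := continuousOn_of_hasDerivAt_Icc h₁
  have c₂ := continuousOn_of_hasDerivAt_Icc h₂
  have c₃ := continuousOn_of_hasDerivAt_Icc h₃
  rw [integral_mul_deriv_of_boundary hab h₀ h₃ c₁ h₄ (by simp [ha, hb]),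
    integral_mul_deriv_of_boundary hab h₁ h₂ c₂ c₃ (by simp [ha₂, hb₂]), neg_neg]
  exact intervalIntegral.integral_nonneg hab fun x _ => mul_self_nonneg _

theorem integral_mul_mul_deriv {a b : ℝ} (hab : a ≤ b) {φ φ₁ F F₁ v v₁ : ℝ → ℝ}
    (hφ : ∀ x ∈ Icc a b, HasDerivAt φ (φ₁ x) x) (hF : ∀ x ∈ Icc a b, HasDerivAt F (F₁ x) x)
    (hv : ∀ x ∈ Icc a b, HasDerivAt v (v₁ x) x) (cφ : ContinuousOn φ₁ (Icc a b))
    (cF : ContinuousOn F₁ (Icc a b)) (cv : ContinuousOn v₁ (Icc a b))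
    (ha : v a = 0) (hb : v b = 0) :
    ∫ x in a..b, φ x * (F x * v₁ x) = - ∫ x in a..b, (φ₁ x * F x + φ x * F₁ x) * v x := by
  have c1 := continuousOn_of_hasDerivAt_Icc hφ
  have c2 := continuousOn_of_hasDerivAt_Icc hF
  rw [← integral_mul_deriv_of_boundary hab (g := fun x => φ x * F x)
    (fun x hx => (hφ x hx).mul (hF x hx)) hv (by fun_prop) cv (by simp [ha, hb])]
  simp only [mul_assoc]

theorem difference_flux_pointwise {M S Sh r : ℝ} (hM : 0 ≤ M) (hr : 0 < r)
    {w v vh T₁ Th₁ θ p q F Fh : ℝ} (hw : w = vh - v) (hp : |p| ≤ M) (hpq : |p - q| ≤ M * |θ|)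
    (hFh : |Fh| ≤ M * Sh) (hF : |Fh - F| ≤ M * |θ|) (hθ : |θ| ≤ S) :
    -(w * (p * Th₁ - q * T₁)) + (Th₁ - T₁) * (Fh * vh - F * v)
        + θ * (p * Th₁ * vh - q * T₁ * v)
      ≤ 3 / 8 * (Th₁ - T₁) ^ 2 + (2 * M ^ 2 + 2 * M ^ 2 * Sh ^ 2 + 2 * M ^ 2 * r ^ 2) * w ^ 2
        + (8 * M ^ 2 * S ^ 2 + M * S ^ 2 / 2 * r) * v ^ 2
        + (S ^ 2 / (4 * r ^ 2) * (T₁ ^ 2 + Th₁ ^ 2) + M * S ^ 2 / 2 * (T₁ ^ 2 / r)) := by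
  have hS : 0 ≤ S := (abs_nonneg θ).trans hθ
  have hpqS : |p - q| ≤ M * S := hpq.trans (by gcongr)
  have hFS : |Fh - F| ≤ M * S := hF.trans (by gcongr)
  have hid : -(w * (p * Th₁ - q * T₁)) + (Th₁ - T₁) * (Fh * vh - F * v)
        + θ * (p * Th₁ * vh - q * T₁ * v)
      = -(w * p * (Th₁ - T₁)) + -(w * (p - q) * T₁) + (Th₁ - T₁) * Fh * w
        + (Th₁ - T₁) * (Fh - F) * v + θ * p * Th₁ * w + θ * p * (Th₁ - T₁) * v
        + θ * (p - q) * T₁ * v := by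
    rw [hw]; ring
  rw [hid]
  have young : ∀ {c k x y : ℝ}, 0 ≤ c → |k| ≤ c → k * x * y ≤ 1 / 8 * x ^ 2 + 2 * c ^ 2 * y ^ 2 := by
    intro c k x y _ hk
    have h1 : k ^ 2 ≤ c ^ 2 := sq_le_sq' (abs_le.1 hk).1 (abs_le.1 hk).2
    nlinarith [sq_nonneg (x - 4 * (k * y)), mul_le_mul_of_nonneg_right h1 (sq_nonneg y)]
  have youngr : ∀ {k x y : ℝ}, |k| ≤ M * S →
      k * x * y ≤ S ^ 2 / (4 * r ^ 2) * x ^ 2 + M ^ 2 * r ^ 2 * y ^ 2 := by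
    intro k x y hk
    have h1 : k * x * y ≤ M * S * (|x| * |y|) := by
      calc k * x * y ≤ |k * x * y| := le_abs_self _
        _ = |k| * (|x| * |y|) := by rw [abs_mul, abs_mul, mul_assoc]
        _ ≤ _ := by gcongr
    have h2 : S ^ 2 / (4 * r ^ 2) * x ^ 2 + M ^ 2 * r ^ 2 * y ^ 2 - M * S * (|x| * |y|)
        = (S * |x| / (2 * r) - M * r * |y|) ^ 2 := by
      rw [← sq_abs x, ← sq_abs y]; field_simp; ring
    nlinarith [sq_nonneg (S * |x| / (2 * r) - M * r * |y|)]
  have hMS : 0 ≤ M * S := by positivity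
  have t1 : -(w * p * (Th₁ - T₁)) ≤ 1 / 8 * (Th₁ - T₁) ^ 2 + 2 * M ^ 2 * w ^ 2 := by
    have := young (k := -p) (x := Th₁ - T₁) (y := w) hM (by rwa [abs_neg])
    linarith
  have t2 : -(w * (p - q) * T₁) ≤ S ^ 2 / (4 * r ^ 2) * T₁ ^ 2 + M ^ 2 * r ^ 2 * w ^ 2 := by
    have := youngr (k := -(p - q)) (x := T₁) (y := w) (by rwa [abs_neg])
    linarith
  have t3 : (Th₁ - T₁) * Fh * w ≤ 1 / 8 * (Th₁ - T₁) ^ 2 + 2 * (M * Sh) ^ 2 * w ^ 2 := by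
    have := young (k := Fh) (x := Th₁ - T₁) (y := w) ((abs_nonneg _).trans hFh) hFh
    linarith
  have hθp : |θ * p| ≤ M * S := by
    rw [abs_mul, mul_comm]; gcongr
  have t46 : (Th₁ - T₁) * (Fh - F) * v + θ * p * (Th₁ - T₁) * v
      ≤ 1 / 8 * (Th₁ - T₁) ^ 2 + 2 * (2 * (M * S)) ^ 2 * v ^ 2 := by
    have := young (k := (Fh - F) + θ * p) (x := Th₁ - T₁) (y := v) (c := 2 * (M * S))
      (by positivity) ((abs_add_le _ _).trans (by linarith))
    linarith
  have t5 : θ * p * Th₁ * w ≤ S ^ 2 / (4 * r ^ 2) * Th₁ ^ 2 + M ^ 2 * r ^ 2 * w ^ 2 :=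
    youngr hθp
  have t7 : θ * (p - q) * T₁ * v ≤ M * S ^ 2 / 2 * (T₁ ^ 2 / r) + M * S ^ 2 / 2 * r * v ^ 2 := by
    have h1 : θ * (p - q) * T₁ * v ≤ S * (M * S) * (|T₁| * |v|) := by
      calc θ * (p - q) * T₁ * v ≤ |θ * (p - q) * T₁ * v| := le_abs_self _
        _ = |θ| * |p - q| * (|T₁| * |v|) := by rw [abs_mul, abs_mul, abs_mul, mul_assoc]
        _ ≤ _ := by gcongr
    have h2 : T₁ ^ 2 / r + r * v ^ 2 - 2 * (|T₁| * |v|) = (|T₁| - r * |v|) ^ 2 / r := by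
      rw [← sq_abs T₁, ← sq_abs v]; field_simp; ring
    have h3 : 0 ≤ (|T₁| - r * |v|) ^ 2 / r := by positivity
    have h4 : 2 * (|T₁| * |v|) ≤ T₁ ^ 2 / r + r * v ^ 2 := by linarith
    have h5 := mul_le_mul_of_nonneg_left h4 (show 0 ≤ M * S ^ 2 / 2 by positivity)
    linarith
  linarith [t1, t2, t3, t46, t5, t7]

/-- A `C¹` function on the half-line, vanishing at `0`, with `f` and `f'` Lipschitz. -/
structure LipschitzNonlinearity (f f' : ℝ → ℝ) (M : ℝ) : Prop where
  nonneg : 0 ≤ M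
  hasDerivAt : ∀ x, 0 < x → HasDerivAt f (f' x) x
  cont : ContinuousOn f' (Ici 0)
  bdd : ∀ x, 0 ≤ x → |f' x| ≤ M
  growth : ∀ x, 0 ≤ x → |f x| ≤ M * x
  lip : ∀ x y, 0 ≤ x → 0 ≤ y → |f x - f y| ≤ M * |x - y|
  lip_deriv : ∀ x y, 0 ≤ x → 0 ≤ y → |f' x - f' y| ≤ M * |x - y|

theorem HypF.exists_lipschitzNonlinearity {f f' f'' : ℝ → ℝ} (hf : HypF f f' f'') :
    ∃ M, LipschitzNonlinearity f f' M := by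
  obtain ⟨M, hM⟩ := hf.bdd
  have lip : ∀ x y, 0 ≤ x → 0 ≤ y → |f x - f y| ≤ M * |x - y| := fun x y hx hy =>
    Convex.norm_image_sub_le_of_norm_hasDerivWithin_le hf.hasDeriv₁ (fun z hz => (hM z hz).1)
      (convex_Ici 0) hy hx
  refine ⟨M, (abs_nonneg _).trans (hM 0 self_mem_Ici).1, fun x hx => ?_, fun x hx => ?_,
    fun x hx => (hM x hx).1, fun x hx => ?_, lip, fun x y hx hy => ?_⟩
  · exact (hf.hasDeriv₁ x hx.le).hasDerivAt (Ici_mem_nhds hx)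
  · exact (hf.hasDeriv₂ x hx).continuousWithinAt
  · simpa [hf.zero, abs_of_nonneg hx] using lip x 0 hx le_rfl
  · exact Convex.norm_image_sub_le_of_norm_hasDerivWithin_le hf.hasDeriv₂
      (fun z hz => (hM z hz).2) (convex_Ici 0) hy hx

theorem heat_flux_le {a b : ℝ} (hab : a < b) {f f' : ℝ → ℝ} {M : ℝ}
    (hf : LipschitzNonlinearity f f' M) {Θ Θ₁ v : ℝ → ℝ} {K : ℝ}
    (hΘ : ∀ x ∈ Icc a b, HasDerivAt Θ (Θ₁ x) x) (cΘ₁ : ContinuousOn Θ₁ (Icc a b))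
    (pos : ∀ x ∈ Icc a b, 0 < Θ x) (cv : ContinuousOn v (Icc a b))
    (cf : ContinuousOn (fun x => f (Θ x)) (Icc a b))
    (cf' : ContinuousOn (fun x => f' (Θ x)) (Icc a b))
    (hK : ∫ x in a..b, v x ^ 2 ≤ K) :
    ∫ x in a..b, (Θ₁ x * f (Θ x) + Θ x * (f' (Θ x) * Θ₁ x)) * v x ≤
      1 / 2 * (∫ x in a..b, Θ₁ x ^ 2)
        + 4 * M ^ 2 * K * ((b - a)⁻¹ + 4 * (4 * M ^ 2 * K + 1)) * ∫ x in a..b, Θ x ^ 2 := by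
  have cΘ := continuousOn_of_hasDerivAt_Icc hΘ
  have hM := hf.nonneg
  have hK0 : 0 ≤ K := (integral_sq_nonneg hab.le v).trans hK
  have hE := integral_sq_nonneg hab.le Θ
  have hP := integral_sq_nonneg hab.le Θ₁
  have hV := integral_sq_nonneg hab.le v
  set E := ∫ x in a..b, Θ x ^ 2
  set P := ∫ x in a..b, Θ₁ x ^ 2
  set V := ∫ x in a..b, v x ^ 2
  set s : ℝ := 4 * M ^ 2 * K with hs
  have hs0 : 0 ≤ s := by positivity
  have hL : 0 < (b - a)⁻¹ := inv_pos.2 (sub_pos.2 hab)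
  set η : ℝ := (4 * (s + 1))⁻¹ with hη
  have hη0 : 0 < η := by positivity
  set S : ℝ := ((b - a)⁻¹ + η⁻¹) * E + η * P with hS
  have hS0 : 0 ≤ S := by positivity
  have hpt : ∀ x ∈ Icc a b, (Θ₁ x * f (Θ x) + Θ x * (f' (Θ x) * Θ₁ x)) * v x ≤
      1 / 4 * Θ₁ x ^ 2 + 4 * M ^ 2 * S * v x ^ 2 := by
    intro x hx
    have hsob : Θ x ^ 2 ≤ S := sq_le_integral_sq_add hab hΘ cΘ₁ hη0 hx
    have h0 := (pos x hx).le
    have h1 : |f (Θ x) + Θ x * f' (Θ x)| ≤ 2 * M * Θ x := by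
      refine (abs_add_le _ _).trans ?_
      rw [abs_mul, abs_of_nonneg h0]
      have := mul_le_mul_of_nonneg_left (hf.bdd _ h0) h0
      linarith [hf.growth _ h0]
    have h2 : (f (Θ x) + Θ x * f' (Θ x)) ^ 2 ≤ 4 * M ^ 2 * S := by
      have h3 : (f (Θ x) + Θ x * f' (Θ x)) ^ 2 ≤ (2 * M * Θ x) ^ 2 :=
        sq_le_sq' (abs_le.1 h1).1 (abs_le.1 h1).2
      have h4 : 4 * M ^ 2 * Θ x ^ 2 ≤ 4 * M ^ 2 * S := by gcongr
      linarith
    nlinarith [sq_nonneg (1 / 2 * Θ₁ x - (f (Θ x) + Θ x * f' (Θ x)) * v x),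
      mul_le_mul_of_nonneg_right h2 (sq_nonneg (v x))]
  have hc : ContinuousOn (fun x => (Θ₁ x * f (Θ x) + Θ x * (f' (Θ x) * Θ₁ x)) * v x)
    (Icc a b) := ((cΘ₁.mul cf).add (cΘ.mul (cf'.mul cΘ₁))).mul cv
  have hI := integral_mono_of_continuousOn hab.le hc (by fun_prop) hpt
  rw [intervalIntegral.integral_add
      (ContinuousOn.intervalIntegrable_of_Icc hab.le (by fun_prop))
      (ContinuousOn.intervalIntegrable_of_Icc hab.le (by fun_prop)),
    intervalIntegral.integral_const_mul, intervalIntegral.integral_const_mul] at hI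
  have h1 : 4 * M ^ 2 * S * V ≤ s * S := by
    rw [hs]
    have := mul_le_mul_of_nonneg_left hK (show 0 ≤ 4 * M ^ 2 * S by positivity)
    linarith
  have h2 : s * η ≤ 1 / 4 := by
    rw [hη, ← div_eq_mul_inv, div_le_iff₀ (by positivity)]; linarith
  have h3 : s * S = s * ((b - a)⁻¹ + 4 * (s + 1)) * E + s * η * P := by
    rw [hS, hη, inv_inv]; ring
  have h4 := mul_le_mul_of_nonneg_right h2 hP
  linarith

/-- Growth constant in the differential inequality for time-shift differences. -/
def differenceRate (L M K K₂ : ℝ) : ℝ :=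
  2 * M ^ 2 + 2 * M ^ 2 * ((L⁻¹ + 1) * K₂ + 1) + 2 * M ^ 2
    + (8 * M ^ 2 * K + 1 / 2 + M / 2 * (1 + K)) * L⁻¹
    + 8 * (8 * M ^ 2 * K + 1 / 2 + M / 2 * (1 + K)) ^ 2

theorem differenceRate_nonneg {L M K K₂ : ℝ} (hL : 0 < L) (hM : 0 ≤ M) (hK : 0 ≤ K)
    (hK₂ : 0 ≤ K₂) : 0 ≤ differenceRate L M K K₂ := by
  unfold differenceRate; positivity

theorem differenceRate_bound {L M K K₂ r V D W Y P Ph Eh S2 Sh2 : ℝ} (hL : 0 < L)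
    (hM : 0 ≤ M) (hr1 : 1 ≤ r) (hK0 : 0 ≤ K) (hK20 : 0 ≤ K₂) (hK₂ : Eh ≤ K₂)
    (hK : V ≤ K) (hD : 0 ≤ D) (hW : 0 ≤ W) (hY : 0 ≤ Y)
    (hPr : P ≤ r ^ 2) (hPhr : Ph ≤ r ^ 2)
    (hS2 : S2 = (L⁻¹ + ((8 * (8 * M ^ 2 * K + 1 / 2 + M / 2 * (1 + K)) * r)⁻¹)⁻¹) * Y
      + (8 * (8 * M ^ 2 * K + 1 / 2 + M / 2 * (1 + K)) * r)⁻¹ * D)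
    (hSh2 : Sh2 = (L⁻¹ + 1⁻¹) * Eh + 1 * Ph) :
    3 / 8 * D + (2 * M ^ 2 + 2 * M ^ 2 * Sh2 + 2 * M ^ 2 * r ^ 2) * W
      + (8 * M ^ 2 * S2 + M * S2 / 2 * r) * V + (S2 / (4 * r ^ 2) + M * S2 / 2 / r) * P
      + S2 / (4 * r ^ 2) * Ph ≤
    1 / 2 * D + differenceRate L M K K₂ * r ^ 2 * (W + Y) := by
  have hr0 : 0 < r := by linarith
  set q : ℝ := 8 * M ^ 2 * K + 1 / 2 + M / 2 * (1 + K) with hq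
  have hq0 : 0 < q := by positivity
  have hS20 : 0 ≤ S2 := by rw [hS2]; positivity
  have hone : 1 ≤ r ^ 2 := by nlinarith
  have hSh : Sh2 ≤ ((L⁻¹ + 1) * K₂ + 1) * r ^ 2 := by
    have h1 : (L⁻¹ + 1) * Eh ≤ (L⁻¹ + 1) * K₂ := by gcongr
    have h2 : 0 ≤ (L⁻¹ + 1) * K₂ := by positivity
    rw [hSh2, inv_one]
    have h3 := mul_le_mul_of_nonneg_left hone h2
    linarith
  have hWcoef : 2 * M ^ 2 + 2 * M ^ 2 * Sh2 + 2 * M ^ 2 * r ^ 2 ≤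
      (2 * M ^ 2 + 2 * M ^ 2 * ((L⁻¹ + 1) * K₂ + 1) + 2 * M ^ 2) * r ^ 2 := by
    have h1 := mul_le_mul_of_nonneg_left hSh (show 0 ≤ 2 * M ^ 2 by positivity)
    have h2 := mul_le_mul_of_nonneg_left hone (show 0 ≤ 2 * M ^ 2 by positivity)
    linarith
  have hVterm : (8 * M ^ 2 * S2 + M * S2 / 2 * r) * V ≤ (8 * M ^ 2 * S2 + M * S2 / 2 * r) * K := by
    gcongr
  have hdiv : S2 / (4 * r ^ 2) * r ^ 2 = S2 / 4 := by field_simp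
  have hdiv' : M * S2 / 2 / r * r ^ 2 = M * S2 / 2 * r := by field_simp
  have hPterm : (S2 / (4 * r ^ 2) + M * S2 / 2 / r) * P ≤ S2 / 4 + M * S2 / 2 * r := by
    rw [← hdiv, ← hdiv', ← add_mul]; gcongr
  have hPhterm : S2 / (4 * r ^ 2) * Ph ≤ S2 / 4 := by
    rw [← hdiv]; gcongr
  have hSterm : (8 * M ^ 2 * S2 + M * S2 / 2 * r) * K + (S2 / 4 + M * S2 / 2 * r) + S2 / 4 ≤
      S2 * (q * r) := by
    have h1 := mul_le_mul_of_nonneg_left hr1 (show 0 ≤ S2 * (8 * M ^ 2 * K + 1 / 2) by positivity)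
    rw [hq]; linarith
  have hSval : S2 * (q * r) = (q * r * L⁻¹ + 8 * q ^ 2 * r ^ 2) * Y + 1 / 8 * D := by
    rw [hS2]; field_simp
  have hrr : q * r * L⁻¹ ≤ q * L⁻¹ * r ^ 2 := by
    have h1 : r ≤ r ^ 2 := by nlinarith
    have h2 := mul_le_mul_of_nonneg_left h1 (show 0 ≤ q * L⁻¹ by positivity)
    linarith
  have hYterm : (q * r * L⁻¹ + 8 * q ^ 2 * r ^ 2) * Y ≤
      (q * L⁻¹ + 8 * q ^ 2) * r ^ 2 * Y := by
    refine mul_le_mul_of_nonneg_right ?_ hY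
    linarith
  have hWterm := mul_le_mul_of_nonneg_right hWcoef hW
  have hA : 0 ≤ (2 * M ^ 2 + 2 * M ^ 2 * ((L⁻¹ + 1) * K₂ + 1) + 2 * M ^ 2) * r ^ 2 * Y := by
    positivity
  have hB : 0 ≤ (q * L⁻¹ + 8 * q ^ 2) * r ^ 2 * W := by positivity
  have hrate : differenceRate L M K K₂ =
      (2 * M ^ 2 + 2 * M ^ 2 * ((L⁻¹ + 1) * K₂ + 1) + 2 * M ^ 2)
        + (q * L⁻¹ + 8 * q ^ 2) := by
    rw [differenceRate]; ring
  rw [hrate]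
  linarith

theorem difference_flux_le {a b : ℝ} (hab : a < b) {f f' : ℝ → ℝ} {M : ℝ}
    (hf : LipschitzNonlinearity f f' M) {Θ Θ₁ Θh Θh₁ v vh : ℝ → ℝ} {K K₂ : ℝ}
    (hΘ : ∀ x ∈ Icc a b, HasDerivAt Θ (Θ₁ x) x) (cΘ₁ : ContinuousOn Θ₁ (Icc a b))
    (hΘh : ∀ x ∈ Icc a b, HasDerivAt Θh (Θh₁ x) x) (cΘh₁ : ContinuousOn Θh₁ (Icc a b))
    (pos : ∀ x ∈ Icc a b, 0 < Θ x) (posh : ∀ x ∈ Icc a b, 0 < Θh x)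
    (cv : ContinuousOn v (Icc a b)) (cvh : ContinuousOn vh (Icc a b))
    (cf : ContinuousOn (fun x => f (Θ x)) (Icc a b))
    (cf' : ContinuousOn (fun x => f' (Θ x)) (Icc a b))
    (cfh : ContinuousOn (fun x => f (Θh x)) (Icc a b))
    (cfh' : ContinuousOn (fun x => f' (Θh x)) (Icc a b))
    (hK : ∫ x in a..b, v x ^ 2 ≤ K) (hK₂ : ∫ x in a..b, Θh x ^ 2 ≤ K₂) :
    ∫ x in a..b, (-((vh x - v x) * (f' (Θh x) * Θh₁ x - f' (Θ x) * Θ₁ x))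
        + (Θh₁ x - Θ₁ x) * (f (Θh x) * vh x - f (Θ x) * v x)
        + (Θh x - Θ x) * (f' (Θh x) * Θh₁ x * vh x - f' (Θ x) * Θ₁ x * v x)) ≤
      1 / 2 * (∫ x in a..b, (Θh₁ x - Θ₁ x) ^ 2)
        + differenceRate (b - a) M K K₂
          * (1 + (∫ x in a..b, Θ₁ x ^ 2) + ∫ x in a..b, Θh₁ x ^ 2)
          * ((∫ x in a..b, (vh x - v x) ^ 2) + ∫ x in a..b, (Θh x - Θ x) ^ 2) := by
  have cΘ := continuousOn_of_hasDerivAt_Icc hΘ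
  have cΘh := continuousOn_of_hasDerivAt_Icc hΘh
  have hM := hf.nonneg
  have hK0 : 0 ≤ K := (integral_sq_nonneg hab.le v).trans hK
  have hK20 : 0 ≤ K₂ := (integral_sq_nonneg hab.le Θh).trans hK₂
  have hEh := integral_sq_nonneg hab.le Θh
  have hP := integral_sq_nonneg hab.le Θ₁
  have hPh := integral_sq_nonneg hab.le Θh₁
  have hV := integral_sq_nonneg hab.le v
  have hD := integral_sq_nonneg hab.le (fun x => Θh₁ x - Θ₁ x)
  have hW := integral_sq_nonneg hab.le (fun x => vh x - v x)
  have hY := integral_sq_nonneg hab.le (fun x => Θh x - Θ x)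
  set Eh := ∫ x in a..b, Θh x ^ 2
  set P := ∫ x in a..b, Θ₁ x ^ 2
  set Ph := ∫ x in a..b, Θh₁ x ^ 2
  set V := ∫ x in a..b, v x ^ 2
  set D := ∫ x in a..b, (Θh₁ x - Θ₁ x) ^ 2
  set W := ∫ x in a..b, (vh x - v x) ^ 2
  set Y := ∫ x in a..b, (Θh x - Θ x) ^ 2
  have hL : 0 < (b - a)⁻¹ := inv_pos.2 (sub_pos.2 hab)
  set r : ℝ := √(1 + P + Ph) with hr
  have hr2 : r ^ 2 = 1 + P + Ph := Real.sq_sqrt (by positivity)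
  have hr1 : 1 ≤ r := Real.one_le_sqrt.2 (by linarith)
  have hr0 : 0 < r := by linarith
  set q : ℝ := 8 * M ^ 2 * K + 1 / 2 + M / 2 * (1 + K) with hq
  have hq0 : 0 < q := by positivity
  set η : ℝ := (8 * q * r)⁻¹ with hη
  have hη0 : 0 < η := by positivity
  set S2 : ℝ := ((b - a)⁻¹ + η⁻¹) * Y + η * D with hS2
  have hS20 : 0 ≤ S2 := by positivity
  set Sh2 : ℝ := ((b - a)⁻¹ + 1⁻¹) * Eh + 1 * Ph with hSh2
  have hSh20 : 0 ≤ Sh2 := by positivity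
  have hpt := fun x (hx : x ∈ Icc a b) =>
    difference_flux_pointwise (S := √S2) (Sh := √Sh2) (T₁ := Θ₁ x) (Th₁ := Θh₁ x)
      hM hr0 (w := vh x - v x) rfl
      (hf.bdd _ (posh x hx).le) (hf.lip_deriv _ _ (posh x hx).le (pos x hx).le)
      ((hf.growth _ (posh x hx).le).trans (mul_le_mul_of_nonneg_left (Real.le_sqrt_of_sq_le
        (sq_le_integral_sq_add hab hΘh cΘh₁ one_pos hx)) hM))
      (hf.lip _ _ (posh x hx).le (pos x hx).le)
      (Real.abs_le_sqrt (sq_le_integral_sq_add hab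
        (g := fun x => Θh x - Θ x) (g' := fun x => Θh₁ x - Θ₁ x)
        (fun y hy => (hΘh y hy).sub (hΘ y hy)) (by fun_prop) hη0 hx))
  simp only [Real.sq_sqrt hS20, Real.sq_sqrt hSh20] at hpt
  have hI := integral_mono_of_continuousOn hab.le
    (((((cvh.sub cv).mul ((cfh'.mul cΘh₁).sub (cf'.mul cΘ₁))).neg).add
      ((cΘh₁.sub cΘ₁).mul ((cfh.mul cvh).sub (cf.mul cv)))).add
      ((cΘh.sub cΘ).mul (((cfh'.mul cΘh₁).mul cvh).sub ((cf'.mul cΘ₁).mul cv))))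
    (by fun_prop) hpt
  refine hI.trans ?_
  have hlin := integral_linear_combination hab.le
    (g₁ := fun x => (Θh₁ x - Θ₁ x) ^ 2) (g₂ := fun x => (vh x - v x) ^ 2)
    (g₃ := fun x => v x ^ 2) (g₄ := fun x => Θ₁ x ^ 2) (g₅ := fun x => Θh₁ x ^ 2)
    (by fun_prop) (by fun_prop) (by fun_prop) (by fun_prop) (by fun_prop)
    (3 / 8) (2 * M ^ 2 + 2 * M ^ 2 * Sh2 + 2 * M ^ 2 * r ^ 2)
    (8 * M ^ 2 * S2 + M * S2 / 2 * r) (S2 / (4 * r ^ 2) + M * S2 / 2 / r) (S2 / (4 * r ^ 2))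
  have hcongr : ∀ x ∈ Icc a b, _ = _ := fun x _ =>
    (show 3 / 8 * (Θh₁ x - Θ₁ x) ^ 2
        + (2 * M ^ 2 + 2 * M ^ 2 * Sh2 + 2 * M ^ 2 * r ^ 2) * (vh x - v x) ^ 2
        + (8 * M ^ 2 * S2 + M * S2 / 2 * r) * v x ^ 2
        + (S2 / (4 * r ^ 2) * (Θ₁ x ^ 2 + Θh₁ x ^ 2) + M * S2 / 2 * (Θ₁ x ^ 2 / r)) =
      3 / 8 * (Θh₁ x - Θ₁ x) ^ 2
        + (2 * M ^ 2 + 2 * M ^ 2 * Sh2 + 2 * M ^ 2 * r ^ 2) * (vh x - v x) ^ 2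
        + (8 * M ^ 2 * S2 + M * S2 / 2 * r) * v x ^ 2
        + (S2 / (4 * r ^ 2) + M * S2 / 2 / r) * Θ₁ x ^ 2 + S2 / (4 * r ^ 2) * Θh₁ x ^ 2 by ring)
  rw [integral_eq_of_eqOn_Icc hab.le hcongr, hlin]
  change 3 / 8 * D + (2 * M ^ 2 + 2 * M ^ 2 * Sh2 + 2 * M ^ 2 * r ^ 2) * W
    + (8 * M ^ 2 * S2 + M * S2 / 2 * r) * V + (S2 / (4 * r ^ 2) + M * S2 / 2 / r) * P
    + S2 / (4 * r ^ 2) * Ph ≤ _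
  rw [← hr2]
  exact differenceRate_bound (inv_pos.1 hL) hM hr1 hK0 hK20 hK₂ hK hD hW hY
    (by linarith) (by linarith) rfl rfl

/-- `g` is `C¹` in time on `[a,b] × [0,∞)` with time derivative `gt`. -/
structure TimeC1 (a b : ℝ) (g gt : ℝ → ℝ → ℝ) : Prop where
  hasDerivAt : ∀ x ∈ Icc a b, ∀ t ∈ Ici (0 : ℝ), HasDerivAt (fun s => g x s) (gt x t) t
  cont : ContinuousOn (uncurry g) (Icc a b ×ˢ Ici 0)
  cont_deriv : ContinuousOn (uncurry gt) (Icc a b ×ˢ Ici 0)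

/-- `g` is `C¹` in space on `[a,b] × [0,∞)` with space derivative `gx`. -/
structure SpaceC1 (a b : ℝ) (g gx : ℝ → ℝ → ℝ) : Prop where
  hasDerivAt : ∀ t ∈ Ici (0 : ℝ), ∀ x ∈ Icc a b, HasDerivAt (fun y => g y t) (gx x t) x
  cont : ContinuousOn (uncurry g) (Icc a b ×ˢ Ici 0)
  cont_deriv : ContinuousOn (uncurry gx) (Icc a b ×ˢ Ici 0)

/-- The time-shift difference `w(·,t+h) - w(·,t)`. -/
def timeDiff (h : ℝ) (w : ℝ → ℝ → ℝ) : ℝ → ℝ → ℝ := fun x t => w x (t + h) - w x t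

theorem continuousOn_slice {a b : ℝ} {g : ℝ → ℝ → ℝ}
    (hg : ContinuousOn (uncurry g) (Icc a b ×ˢ Ici 0)) {t : ℝ} (ht : 0 ≤ t) :
    ContinuousOn (fun x => g x t) (Icc a b) :=
  hg.comp (f := fun x => (x, t)) (by fun_prop) fun _ hx => ⟨hx, ht⟩

theorem continuousOn_shift {a b h : ℝ} (hh : 0 ≤ h) {g : ℝ → ℝ → ℝ}
    (hg : ContinuousOn (uncurry g) (Icc a b ×ˢ Ici 0)) :
    ContinuousOn (uncurry fun x t => g x (t + h)) (Icc a b ×ˢ Ici 0) :=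
  hg.comp (f := fun p : ℝ × ℝ => (p.1, p.2 + h)) (by fun_prop)
    fun _ hp => ⟨hp.1, add_nonneg hp.2 hh⟩

theorem continuousOn_timeDiff {a b h : ℝ} (hh : 0 ≤ h) {g : ℝ → ℝ → ℝ}
    (hg : ContinuousOn (uncurry g) (Icc a b ×ˢ Ici 0)) :
    ContinuousOn (uncurry (timeDiff h g)) (Icc a b ×ˢ Ici 0) :=
  (continuousOn_shift hh hg).sub hg

theorem TimeC1.timeDiff {a b h : ℝ} (hh : 0 ≤ h) {g gt : ℝ → ℝ → ℝ} (hg : TimeC1 a b g gt) :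
    TimeC1 a b (timeDiff h g) (timeDiff h gt) where
  hasDerivAt x hx t ht :=
    ((hg.hasDerivAt x hx (t + h) (add_nonneg ht hh)).comp_add_const t h).sub
      (hg.hasDerivAt x hx t ht)
  cont := continuousOn_timeDiff hh hg.cont
  cont_deriv := continuousOn_timeDiff hh hg.cont_deriv

theorem SpaceC1.timeDiff {a b h : ℝ} (hh : 0 ≤ h) {g gx : ℝ → ℝ → ℝ} (hg : SpaceC1 a b g gx) :
    SpaceC1 a b (timeDiff h g) (timeDiff h gx) where
  hasDerivAt t ht x hx :=
    (hg.hasDerivAt (t + h) (add_nonneg ht hh) x hx).sub (hg.hasDerivAt t ht x hx)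
  cont := continuousOn_timeDiff hh hg.cont
  cont_deriv := continuousOn_timeDiff hh hg.cont_deriv

theorem TimeC1.sq {a b : ℝ} {g gt : ℝ → ℝ → ℝ} (hg : TimeC1 a b g gt) :
    TimeC1 a b (fun x t => g x t ^ 2) (fun x t => 2 * g x t * gt x t) where
  hasDerivAt x hx t ht := by simpa using (hg.hasDerivAt x hx t ht).fun_pow 2
  cont := hg.cont.pow 2
  cont_deriv := (continuousOn_const.mul hg.cont).mul hg.cont_deriv

theorem continuousOn_integral_of_uncurry {a b : ℝ} (hab : a ≤ b) {g : ℝ → ℝ → ℝ}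
    (hg : ContinuousOn (uncurry g) (Icc a b ×ˢ Ici 0)) :
    ContinuousOn (fun t => ∫ x in a..b, g x t) (Ici 0) := by
  have hc : Continuous (uncurry fun t x => g (max a (min b x)) (max 0 t)) :=
    hg.comp_continuous (f := fun p : ℝ × ℝ => (max a (min b p.2), max 0 p.1)) (by fun_prop)
      fun p => ⟨⟨le_max_left _ _, max_le hab (min_le_left _ _)⟩, le_max_left 0 p.1⟩
  have := intervalIntegral.continuous_parametric_intervalIntegral_of_continuous' (μ := volume)
    hc a b
  refine this.continuousOn.congr fun t ht => integral_eq_of_eqOn_Icc hab fun x hx => ?_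
  rw [max_eq_right (mem_Ici.1 ht), min_eq_right hx.2, max_eq_right hx.1]

theorem continuousOn_integral_sq {a b : ℝ} (hab : a ≤ b) {g : ℝ → ℝ → ℝ}
    (hg : ContinuousOn (uncurry g) (Icc a b ×ˢ Ici 0)) :
    ContinuousOn (fun t => ∫ x in a..b, g x t ^ 2) (Ici 0) :=
  continuousOn_integral_of_uncurry hab (g := fun x t => g x t ^ 2) (hg.pow 2)

theorem exists_bound_near {a b t : ℝ} (ht : 0 < t) {g : ℝ → ℝ → ℝ}
    (hg : ContinuousOn (uncurry g) (Icc a b ×ˢ Ici 0)) :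
    ∃ C, ∀ x ∈ Icc a b, ∀ s ∈ Icc (t / 2) (2 * t), |g x s| ≤ C := by
  obtain ⟨C, hC⟩ := (isCompact_Icc.prod isCompact_Icc).exists_bound_of_continuousOn
    (hg.mono (prod_mono_right (fun s hs => (half_pos ht).le.trans hs.1) :
      Icc a b ×ˢ Icc (t / 2) (2 * t) ⊆ _))
  exact ⟨C, fun x hx s hs => hC (x, s) ⟨hx, hs⟩⟩

theorem Icc_half_mem_nhds {t : ℝ} (ht : 0 < t) : Icc (t / 2) (2 * t) ∈ nhds t :=
  Icc_mem_nhds (by linarith) (by linarith)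

theorem aestronglyMeasurable_uIoc {a b : ℝ} (hab : a ≤ b) {g : ℝ → ℝ}
    (hg : ContinuousOn g (Icc a b)) :
    AEStronglyMeasurable g (volume.restrict (uIoc a b)) := by
  rw [uIoc_of_le hab]
  exact (hg.mono Ioc_subset_Icc_self).aestronglyMeasurable measurableSet_Ioc

theorem TimeC1.hasDerivAt_integral {a b : ℝ} (hab : a ≤ b) {g gt : ℝ → ℝ → ℝ}
    (hg : TimeC1 a b g gt) {t : ℝ} (ht : 0 < t) :
    HasDerivAt (fun s => ∫ x in a..b, g x s) (∫ x in a..b, gt x t) t := by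
  obtain ⟨C, hC⟩ := exists_bound_near ht hg.cont_deriv
  refine (intervalIntegral.hasDerivAt_integral_of_dominated_loc_of_deriv_le
    (F := fun s x => g x s) (F' := fun s x => gt x s) (bound := fun _ => C)
    (Icc_half_mem_nhds ht) ?_ ?_ ?_ ?_ ?_ ?_).2
  · filter_upwards [Icc_half_mem_nhds ht] with s hs
    exact aestronglyMeasurable_uIoc hab (continuousOn_slice hg.cont ((half_pos ht).le.trans hs.1))
  · exact (continuousOn_slice hg.cont ht.le).intervalIntegrable_of_Icc hab
  · exact aestronglyMeasurable_uIoc hab (continuousOn_slice hg.cont_deriv ht.le)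
  · refine Eventually.of_forall fun x hx s hs => hC x ?_ s hs
    rw [uIoc_of_le hab] at hx
    exact Ioc_subset_Icc_self hx
  · simp
  · refine Eventually.of_forall fun x hx s hs => ?_
    rw [uIoc_of_le hab] at hx
    exact hg.hasDerivAt x (Ioc_subset_Icc_self hx) s ((half_pos ht).le.trans hs.1)

/-- The Dirichlet energy is differentiable in time although `z` has no mixed derivative. -/
theorem hasDerivAt_integral_deriv_sq {a b : ℝ} (hab : a ≤ b) {z zt z₁ z₂ : ℝ → ℝ → ℝ}
    (hz : TimeC1 a b z zt) (h₁ : SpaceC1 a b z z₁) (h₂ : SpaceC1 a b z₁ z₂)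
    (bc : ∀ t, 0 < t → z a t = 0 ∧ z b t = 0) {t : ℝ} (ht : 0 < t) :
    HasDerivAt (fun s => ∫ x in a..b, z₁ x s ^ 2) (∫ x in a..b, -2 * (zt x t * z₂ x t)) t := by
  obtain ⟨C, hC⟩ := exists_bound_near ht hz.cont_deriv
  obtain ⟨C', hC'⟩ := exists_bound_near ht h₂.cont_deriv
  have htm : t ∈ Icc (t / 2) (2 * t) := mem_of_mem_nhds (Icc_half_mem_nhds ht)
  rw [hasDerivAt_iff_tendsto_slope]
  have hnear : ∀ᶠ s in nhdsWithin t {t}ᶜ, s ∈ Icc (t / 2) (2 * t) ∧ s ≠ t :=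
    (eventually_nhdsWithin_of_eventually_nhds (Icc_half_mem_nhds ht)).and
      eventually_mem_nhdsWithin
  have hslope : ∀ᶠ s in nhdsWithin t {t}ᶜ,
      ∫ x in a..b, -(slope (z x) t s * (z₂ x s + z₂ x t)) =
        slope (fun s => ∫ x in a..b, z₁ x s ^ 2) t s := by
    filter_upwards [hnear] with s hs
    have hs0 : 0 < s := (half_pos ht).trans_le hs.1.1
    have c₁ := continuousOn_slice h₁.cont_deriv hs0.le
    have c₁' := continuousOn_slice h₁.cont_deriv ht.le
    have c₂ := continuousOn_slice h₂.cont_deriv hs0.le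
    have c₂' := continuousOn_slice h₂.cont_deriv ht.le
    have hibp := integral_mul_deriv_of_boundary hab (g := fun x => z x s - z x t)
      (k := fun x => z₁ x s + z₁ x t)
      (fun x hx => (h₁.hasDerivAt s hs0.le x hx).sub (h₁.hasDerivAt t ht.le x hx))
      (fun x hx => (h₂.hasDerivAt s hs0.le x hx).add (h₂.hasDerivAt t ht.le x hx))
      (c₁.sub c₁') (c₂.add c₂')
      (by simp [bc s hs0, bc t ht])
    rw [slope_def_field, ← intervalIntegral.integral_sub
      (ContinuousOn.intervalIntegrable_of_Icc hab (by fun_prop))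
      (ContinuousOn.intervalIntegrable_of_Icc hab (by fun_prop)),
      div_eq_inv_mul]
    have h3 : ∫ x in a..b, (z₁ x s ^ 2 - z₁ x t ^ 2) =
        -∫ x in a..b, (z x s - z x t) * (z₂ x s + z₂ x t) := by
      rw [hibp, neg_neg]
      exact integral_eq_of_eqOn_Icc hab fun x _ => by ring
    rw [h3, ← intervalIntegral.integral_neg, ← intervalIntegral.integral_const_mul]
    refine integral_eq_of_eqOn_Icc hab fun x _ => ?_
    rw [slope_def_field]; ring
  refine Tendsto.congr' hslope ?_
  refine intervalIntegral.tendsto_integral_filter_of_dominated_convergence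
    (fun _ => C * (C' + C')) ?_ ?_ (by simp) ?_
  · filter_upwards [hnear] with s hs
    have hs0 : 0 < s := (half_pos ht).trans_le hs.1.1
    refine aestronglyMeasurable_uIoc hab ?_
    simp only [slope_def_field]
    exact ((((continuousOn_slice hz.cont hs0.le).sub (continuousOn_slice hz.cont ht.le)).div_const
      (s - t)).mul ((continuousOn_slice h₂.cont_deriv hs0.le).add
        (continuousOn_slice h₂.cont_deriv ht.le))).neg
  · filter_upwards [hnear] with s hs
    refine Eventually.of_forall fun x hx => ?_
    rw [uIoc_of_le hab] at hx
    have hx' := Ioc_subset_Icc_self hx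
    have hmv : ‖z x s - z x t‖ ≤ C * ‖s - t‖ :=
      Convex.norm_image_sub_le_of_norm_hasDerivWithin_le (f := z x) (f' := zt x)
        (s := Icc (t / 2) (2 * t))
        (fun r hr => (hz.hasDerivAt x hx' r ((half_pos ht).le.trans hr.1)).hasDerivWithinAt)
        (fun r hr => hC x hx' r hr) (convex_Icc _ _) htm hs.1
    have hsl : |slope (z x) t s| ≤ C := by
      rw [slope_def_field, abs_div]
      exact div_le_of_le_mul₀ (abs_nonneg _) ((abs_nonneg _).trans (hC x hx' t htm)) hmv
    rw [norm_neg, norm_mul]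
    exact mul_le_mul hsl ((abs_add_le _ _).trans (add_le_add (hC' x hx' s hs.1) (hC' x hx' t htm)))
      (abs_nonneg _) ((abs_nonneg _).trans hsl)
  · refine Eventually.of_forall fun x hx => ?_
    rw [uIoc_of_le hab] at hx
    have hx' := Ioc_subset_Icc_self hx
    have hd := hasDerivAt_iff_tendsto_slope.1 (hz.hasDerivAt x hx' t ht.le)
    have hcz : Tendsto (fun s => z₂ x s) (nhdsWithin t {t}ᶜ) (nhds (z₂ x t)) := by
      have hc : ContinuousOn (fun s => z₂ x s) (Ici 0) :=
        h₂.cont_deriv.comp (f := fun s => (x, s)) (by fun_prop) fun _ hs => ⟨hx', hs⟩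
      exact ((hc.continuousAt (Ici_mem_nhds ht)).tendsto).mono_left nhdsWithin_le_nhds
    have hlim := (hd.mul (hcz.add_const (z₂ x t))).neg
    rwa [show -(zt x t * (z₂ x t + z₂ x t)) = -2 * (zt x t * z₂ x t) by ring] at hlim

/-- Grönwall's inequality with a given antiderivative `B` of the rate. -/
theorem le_mul_exp_of_hasDerivAt_le {y B B' : ℝ → ℝ} {t : ℝ} (ht : 0 ≤ t)
    (cy : ContinuousOn y (Ici 0)) (cB : ContinuousOn B (Ici 0))
    (hB : ∀ s, 0 < s → HasDerivAt B (B' s) s)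
    (hy : ∀ s, 0 < s → s < t → ∃ d, HasDerivAt y d s ∧ d ≤ B' s * y s) :
    y t ≤ y 0 * Real.exp (B t - B 0) := by
  have hanti : AntitoneOn (fun s => y s * Real.exp (-B s)) (Icc 0 t) := by
    have hd : ∀ s, 0 < s → s < t → ∃ d, HasDerivAt (fun s => y s * Real.exp (-B s)) d s ∧
        d ≤ 0 := by
      intro s hs hst
      obtain ⟨d, hd, hle⟩ := hy s hs hst
      refine ⟨_, hd.mul (hB s hs).neg.exp, ?_⟩
      change d * Real.exp (-B s) + y s * (Real.exp (-B s) * -B' s) ≤ 0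
      nlinarith [mul_le_mul_of_nonneg_right hle (Real.exp_pos (-B s)).le]
    refine antitoneOn_of_deriv_nonpos (convex_Icc 0 t)
      ((cy.mul cB.neg.rexp).mono Icc_subset_Ici_self) ?_ ?_
    · rw [interior_Icc]
      intro s hs
      obtain ⟨d, hd, _⟩ := hd s hs.1 hs.2
      exact hd.differentiableAt.differentiableWithinAt
    · rw [interior_Icc]
      intro s hs
      obtain ⟨d, hd, hle⟩ := hd s hs.1 hs.2
      rwa [hd.deriv]
  have h := mul_le_mul_of_nonneg_right (hanti (left_mem_Icc.2 ht) (right_mem_Icc.2 ht) ht)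
    (Real.exp_pos (B t)).le
  simp only [mul_assoc, ← Real.exp_add] at h
  rw [neg_add_cancel, Real.exp_zero, mul_one] at h
  rwa [sub_eq_add_neg, add_comm (B t)]

/-- Energy inequality for the mechanical part `wt = -ε w₄ + z₂ - G`, `zt = ε z₂ + w`. -/
theorem mechanical_energy {a b ε : ℝ} (hab : a ≤ b) (hε : 0 ≤ ε)
    {w w₁ w₂ w₃ w₄ wt z z₁ z₂ zt G : ℝ → ℝ → ℝ}
    (hwt : TimeC1 a b w wt) (hw : SpaceC1 a b w w₁) (hw₁ : SpaceC1 a b w₁ w₂)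
    (hw₂ : SpaceC1 a b w₂ w₃) (hw₃ : SpaceC1 a b w₃ w₄)
    (hzt : TimeC1 a b z zt) (hz : SpaceC1 a b z z₁) (hz₁ : SpaceC1 a b z₁ z₂)
    (bcw : ∀ t, 0 < t → w a t = 0 ∧ w b t = 0 ∧ w₂ a t = 0 ∧ w₂ b t = 0)
    (bcz : ∀ t, 0 < t → z a t = 0 ∧ z b t = 0)
    (eqw : ∀ t, 0 < t → ∀ x ∈ Icc a b, wt x t = -ε * w₄ x t + z₂ x t - G x t)
    (eqz : ∀ t, 0 < t → ∀ x ∈ Icc a b, zt x t = ε * z₂ x t + w x t)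
    (hG : ContinuousOn (uncurry G) (Icc a b ×ˢ Ici 0)) {t : ℝ} (ht : 0 < t) :
    ∃ d, HasDerivAt (fun s => (∫ x in a..b, w x s ^ 2) + ∫ x in a..b, z₁ x s ^ 2) d t ∧
      d ≤ 2 * ∫ x in a..b, -(w x t * G x t) := by
  refine ⟨_, (hwt.sq.hasDerivAt_integral hab ht).add
    (hasDerivAt_integral_deriv_sq hab hzt hz hz₁ bcz ht), ?_⟩
  have cw := continuousOn_slice hw.cont ht.le
  have cw₄ := continuousOn_slice hw₃.cont_deriv ht.le
  have cz₂ := continuousOn_slice hz₁.cont_deriv ht.le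
  have cwt := continuousOn_slice hwt.cont_deriv ht.le
  have czt := continuousOn_slice hzt.cont_deriv ht.le
  have cG := continuousOn_slice hG ht.le
  obtain ⟨ha, hb, ha₂, hb₂⟩ := bcw t ht
  have h4 := integral_mul_fourth_deriv_nonneg hab (hw.hasDerivAt t ht.le)
    (hw₁.hasDerivAt t ht.le) (hw₂.hasDerivAt t ht.le) (hw₃.hasDerivAt t ht.le) cw₄ ha hb ha₂ hb₂
  have hz2 := integral_sq_nonneg hab (fun x => z₂ x t)
  rw [← intervalIntegral.integral_add (ContinuousOn.intervalIntegrable_of_Icc hab (by fun_prop))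
    (ContinuousOn.intervalIntegrable_of_Icc hab (by fun_prop))]
  have hcongr : ∫ x in a..b, (2 * w x t * wt x t + -2 * (zt x t * z₂ x t)) =
      ∫ x in a..b, (2 * -(w x t * G x t) + -(2 * ε) * (w x t * w₄ x t)
        + -(2 * ε) * z₂ x t ^ 2 + 0 * 0 + 0 * 0) :=
    integral_eq_of_eqOn_Icc hab fun x hx => by rw [eqw t ht x hx, eqz t ht x hx]; ring
  rw [hcongr, integral_linear_combination hab (g₁ := fun x => -(w x t * G x t))
    (g₂ := fun x => w x t * w₄ x t) (g₃ := fun x => z₂ x t ^ 2) (by fun_prop) (by fun_prop)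
    (by fun_prop) continuousOn_const continuousOn_const]
  nlinarith [mul_nonneg hε h4, mul_nonneg hε hz2]

theorem spaceC1_iterate_pdx {a b : ℝ} {n : ℕ} {g : ℝ → ℝ → ℝ}
    (hd : ∀ k < n, ∀ x ∈ Icc a b, ∀ t ∈ Ici (0 : ℝ),
      DifferentiableAt ℝ (fun y => pdx^[k] g y t) x)
    (hc : ∀ k ≤ n, ContinuousOn (uncurry (pdx^[k] g)) (Icc a b ×ˢ Ici 0)) {k : ℕ} (hk : k < n) :
    SpaceC1 a b (pdx^[k] g) (pdx^[k + 1] g) where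
  hasDerivAt t ht x hx := by
    rw [iterate_succ_apply']
    exact (hd k hk x hx t ht).hasDerivAt
  cont := hc k hk.le
  cont_deriv := hc (k + 1) hk

theorem eq_on_Icc_of_eq_on_Ioo {a b : ℝ} (hab : a < b) {g k : ℝ → ℝ}
    (h : ∀ x ∈ Ioo a b, g x = k x) (hg : ContinuousOn g (Icc a b)) (hk : ContinuousOn k (Icc a b)) :
    ∀ x ∈ Icc a b, g x = k x :=
  EqOn.of_subset_closure (s := Ioo a b) (t := Icc a b) h hg hk Ioo_subset_Icc_self
    (by rw [closure_Ioo hab.ne])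

theorem intervalIntegral_eq_integral_Ioo {a b : ℝ} (hab : a ≤ b) (g : ℝ → ℝ) :
    ∫ x in a..b, g x = ∫ x in Ioo a b, g x := by
  rw [intervalIntegral.integral_of_le hab, integral_Ioc_eq_integral_Ioo]

namespace IsClassicalSolEps

variable {a b ε M : ℝ} {f f' : ℝ → ℝ} {v0 u0 Θ0 : ℝ → ℝ} {v u Θ : ℝ → ℝ → ℝ}

theorem spaceC1_v (hs : IsClassicalSolEps a b f ε v0 u0 Θ0 v u Θ) {k : ℕ} (hk : k < 4) :
    SpaceC1 a b (pdx^[k] v) (pdx^[k + 1] v) :=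
  spaceC1_iterate_pdx hs.diffx_v hs.cont_v hk

theorem spaceC1_u (hs : IsClassicalSolEps a b f ε v0 u0 Θ0 v u Θ) {k : ℕ} (hk : k < 2) :
    SpaceC1 a b (pdx^[k] u) (pdx^[k + 1] u) :=
  spaceC1_iterate_pdx hs.diffx_u hs.cont_u hk

theorem spaceC1_Θ (hs : IsClassicalSolEps a b f ε v0 u0 Θ0 v u Θ) {k : ℕ} (hk : k < 2) :
    SpaceC1 a b (pdx^[k] Θ) (pdx^[k + 1] Θ) :=
  spaceC1_iterate_pdx hs.diffx_Θ hs.cont_Θ hk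

theorem timeC1_v (hs : IsClassicalSolEps a b f ε v0 u0 Θ0 v u Θ) : TimeC1 a b v (pdt v) where
  hasDerivAt x hx t ht := (hs.difft_v x hx t ht).hasDerivAt
  cont := hs.cont_v 0 (by norm_num)
  cont_deriv := hs.contt_v

theorem timeC1_u (hs : IsClassicalSolEps a b f ε v0 u0 Θ0 v u Θ) : TimeC1 a b u (pdt u) where
  hasDerivAt x hx t ht := (hs.difft_u x hx t ht).hasDerivAt
  cont := hs.cont_u 0 (by norm_num)
  cont_deriv := hs.contt_u

theorem timeC1_Θ (hs : IsClassicalSolEps a b f ε v0 u0 Θ0 v u Θ) : TimeC1 a b Θ (pdt Θ) where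
  hasDerivAt x hx t ht := (hs.difft_Θ x hx t ht).hasDerivAt
  cont := hs.cont_Θ 0 (by norm_num)
  cont_deriv := hs.contt_Θ

theorem cont_deriv_f_Θ (hs : IsClassicalSolEps a b f ε v0 u0 Θ0 v u Θ)
    (hf : LipschitzNonlinearity f f' M) :
    ContinuousOn (uncurry fun x t => f' (Θ x t)) (Icc a b ×ˢ Ici 0) :=
  hf.cont.comp hs.timeC1_Θ.cont fun p hp => (hs.Θ_pos p.1 hp.1 p.2 hp.2).le

theorem spaceC1_f_Θ (hs : IsClassicalSolEps a b f ε v0 u0 Θ0 v u Θ)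
    (hf : LipschitzNonlinearity f f' M) :
    SpaceC1 a b (fun x t => f (Θ x t)) (fun x t => f' (Θ x t) * pdx Θ x t) where
  hasDerivAt t ht x hx := (hf.hasDerivAt _ (hs.Θ_pos x hx t ht)).comp x
    ((hs.spaceC1_Θ (k := 0) (by norm_num)).hasDerivAt t ht x hx)
  cont := ContinuousOn.comp (t := Ioi 0)
    (fun x hx => (hf.hasDerivAt x hx).continuousAt.continuousWithinAt)
    hs.timeC1_Θ.cont fun p hp => hs.Θ_pos p.1 hp.1 p.2 hp.2
  cont_deriv := (hs.cont_deriv_f_Θ hf).mul (hs.cont_Θ 1 (by norm_num))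

theorem eq_v_Icc (hs : IsClassicalSolEps a b f ε v0 u0 Θ0 v u Θ) (hab : a < b)
    (hf : LipschitzNonlinearity f f' M) {t : ℝ} (ht : 0 < t) :
    ∀ x ∈ Icc a b, pdt v x t =
      -ε * pdx^[4] v x t + pdx^[2] u x t - f' (Θ x t) * pdx Θ x t := by
  have c₁ := continuousOn_slice (hs.cont_v 4 le_rfl) ht.le
  have c₂ := continuousOn_slice (hs.cont_u 2 le_rfl) ht.le
  refine eq_on_Icc_of_eq_on_Ioo hab (fun x hx => ?_) (continuousOn_slice hs.contt_v ht.le)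
    (((continuousOn_const.mul c₁).add c₂).sub
      (continuousOn_slice (hs.spaceC1_f_Θ hf).cont_deriv ht.le))
  rw [hs.eq_v x hx t ht]
  congr 1
  exact ((hs.spaceC1_f_Θ hf).hasDerivAt t ht.le x (Ioo_subset_Icc_self hx)).deriv

theorem eq_u_Icc (hs : IsClassicalSolEps a b f ε v0 u0 Θ0 v u Θ) (hab : a < b)
    {t : ℝ} (ht : 0 < t) :
    ∀ x ∈ Icc a b, pdt u x t = ε * pdx^[2] u x t + v x t :=
  eq_on_Icc_of_eq_on_Ioo hab (fun x hx => hs.eq_u x hx t ht) (continuousOn_slice hs.contt_u ht.le)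
    ((continuousOn_const.mul (continuousOn_slice (hs.cont_u 2 le_rfl) ht.le)).add
      (continuousOn_slice hs.timeC1_v.cont ht.le))

theorem eq_Θ_Icc (hs : IsClassicalSolEps a b f ε v0 u0 Θ0 v u Θ) (hab : a < b)
    (hf : LipschitzNonlinearity f f' M) {t : ℝ} (ht : 0 < t) :
    ∀ x ∈ Icc a b, pdt Θ x t = pdx^[2] Θ x t - f (Θ x t) * pdx v x t :=
  eq_on_Icc_of_eq_on_Ioo hab (fun x hx => hs.eq_Θ x hx t ht) (continuousOn_slice hs.contt_Θ ht.le)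
    ((continuousOn_slice (hs.cont_Θ 2 le_rfl) ht.le).sub
      ((continuousOn_slice (hs.spaceC1_f_Θ hf).cont ht.le).mul
        (continuousOn_slice (hs.cont_v 1 (by norm_num)) ht.le)))

/-- Weak form of the heat source against a time slice `φ`. -/
theorem integral_mul_source (hs : IsClassicalSolEps a b f ε v0 u0 Θ0 v u Θ) (hab : a < b)
    (hf : LipschitzNonlinearity f f' M) {t : ℝ} (ht : 0 < t) {φ φ₁ : ℝ → ℝ}
    (hφ : ∀ x ∈ Icc a b, HasDerivAt φ (φ₁ x) x) (cφ : ContinuousOn φ₁ (Icc a b)) :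
    ∫ x in a..b, φ x * (f (Θ x t) * pdx v x t) =
      -∫ x in a..b, (φ₁ x * f (Θ x t) + φ x * (f' (Θ x t) * pdx Θ x t)) * v x t :=
  integral_mul_mul_deriv hab.le hφ ((hs.spaceC1_f_Θ hf).hasDerivAt t ht.le)
    ((hs.spaceC1_v (k := 0) (by norm_num)).hasDerivAt t ht.le) cφ
    (continuousOn_slice (hs.spaceC1_f_Θ hf).cont_deriv ht.le)
    (continuousOn_slice (hs.cont_v 1 (by norm_num)) ht.le) (hs.bc_v t ht).1 (hs.bc_v t ht).2.1

/-- Testing the heat equation with a time slice `φ`. -/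
theorem integral_mul_pdt_Θ (hs : IsClassicalSolEps a b f ε v0 u0 Θ0 v u Θ) (hab : a < b)
    (hf : LipschitzNonlinearity f f' M) {t : ℝ} (ht : 0 < t) {φ φ₁ : ℝ → ℝ}
    (hφ : ∀ x ∈ Icc a b, HasDerivAt φ (φ₁ x) x) (cφ : ContinuousOn φ₁ (Icc a b)) :
    ∫ x in a..b, φ x * pdt Θ x t = -(∫ x in a..b, φ₁ x * pdx Θ x t)
      + ∫ x in a..b, (φ₁ x * f (Θ x t) + φ x * (f' (Θ x t) * pdx Θ x t)) * v x t := by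
  have c₀ := continuousOn_of_hasDerivAt_Icc hφ
  have cΘ₂ : ContinuousOn (fun x => pdx^[2] Θ x t) (Icc a b) :=
    continuousOn_slice (hs.cont_Θ 2 le_rfl) ht.le
  have cF := continuousOn_slice (hs.spaceC1_f_Θ hf).cont ht.le
  have cv₁ : ContinuousOn (fun x => pdx v x t) (Icc a b) :=
    continuousOn_slice (hs.cont_v 1 (by norm_num)) ht.le
  have h1 : ∫ x in a..b, φ x * pdt Θ x t =
      ∫ x in a..b, (φ x * pdx^[2] Θ x t - φ x * (f (Θ x t) * pdx v x t)) :=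
    integral_eq_of_eqOn_Icc hab.le fun x hx => by rw [hs.eq_Θ_Icc hab hf ht x hx]; ring
  rw [h1, intervalIntegral.integral_sub ((c₀.fun_mul cΘ₂).intervalIntegrable_of_Icc hab.le)
    ((c₀.fun_mul (cF.fun_mul cv₁)).intervalIntegrable_of_Icc hab.le),
    hs.integral_mul_source hab hf ht hφ cφ, sub_neg_eq_add]
  congr 1
  exact integral_mul_deriv_of_boundary hab.le hφ
    ((hs.spaceC1_Θ (k := 1) (by norm_num)).hasDerivAt t ht.le) cφ cΘ₂
    (by simp [(hs.bc_Θ t ht).1, (hs.bc_Θ t ht).2])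

theorem energy_le (hs : IsClassicalSolEps a b f ε v0 u0 Θ0 v u Θ) (hab : a < b) (hε : 0 ≤ ε)
    (hf : LipschitzNonlinearity f f' M) {t : ℝ} (ht : 0 ≤ t) :
    (∫ x in a..b, v x t ^ 2) + (∫ x in a..b, pdx u x t ^ 2) + 2 * (∫ x in a..b, Θ x t) ≤
      (∫ x in a..b, v x 0 ^ 2) + (∫ x in a..b, pdx u x 0 ^ 2) + 2 * ∫ x in a..b, Θ x 0 := by
  have key := le_mul_exp_of_hasDerivAt_le (B := fun _ => 0) (B' := fun _ => 0)
    (y := fun t => (∫ x in a..b, v x t ^ 2) + (∫ x in a..b, pdx u x t ^ 2)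
      + 2 * (∫ x in a..b, Θ x t)) ht
    (((continuousOn_integral_sq hab.le hs.timeC1_v.cont).add
      (continuousOn_integral_sq hab.le (hs.cont_u 1 (by norm_num)))).add
      (continuousOn_const.mul (continuousOn_integral_of_uncurry hab.le hs.timeC1_Θ.cont)))
    continuousOn_const (fun s _ => hasDerivAt_const s 0) (fun s hs0 _ => ?_)
  · simpa using key
  · obtain ⟨d, hd, hle⟩ := mechanical_energy hab.le hε hs.timeC1_v
      (hs.spaceC1_v (k := 0) (by norm_num)) (hs.spaceC1_v (k := 1) (by norm_num))
      (hs.spaceC1_v (k := 2) (by norm_num)) (hs.spaceC1_v (k := 3) (by norm_num)) hs.timeC1_u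
      (hs.spaceC1_u (k := 0) (by norm_num)) (hs.spaceC1_u (k := 1) (by norm_num))
      hs.bc_v hs.bc_u (fun t ht => hs.eq_v_Icc hab hf ht) (fun t ht => hs.eq_u_Icc hab ht)
      (hs.spaceC1_f_Θ hf).cont_deriv hs0
    refine ⟨_, hd.add ((hs.timeC1_Θ.hasDerivAt_integral hab.le hs0).const_mul 2), ?_⟩
    have h1 := hs.integral_mul_pdt_Θ hab hf hs0 (φ := fun _ => 1) (φ₁ := fun _ => 0)
      (fun x _ => hasDerivAt_const x 1) continuousOn_const
    simp only [one_mul, zero_mul, zero_add, intervalIntegral.integral_zero, neg_zero] at h1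
    have h2 : ∫ x in a..b, -(v x s * (f' (Θ x s) * pdx Θ x s)) =
        -∫ x in a..b, f' (Θ x s) * pdx Θ x s * v x s := by
      rw [← intervalIntegral.integral_neg]
      exact integral_eq_of_eqOn_Icc hab.le fun x _ => by ring
    rw [h2] at hle
    rw [h1, zero_mul]
    linarith

/-- Growth constant in the energy inequality for the temperature. -/
def heatRate (L M K : ℝ) : ℝ := 4 * M ^ 2 * K * (L⁻¹ + 4 * (4 * M ^ 2 * K + 1))

theorem heatRate_nonneg {L M K : ℝ} (hL : 0 < L) (hK : 0 ≤ K) : 0 ≤ heatRate L M K := by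
  unfold heatRate; positivity

theorem temperature_energy (hs : IsClassicalSolEps a b f ε v0 u0 Θ0 v u Θ) (hab : a < b)
    (hf : LipschitzNonlinearity f f' M) {K t : ℝ} (ht : 0 < t)
    (hK : ∫ x in a..b, v x t ^ 2 ≤ K) :
    (∫ x in a..b, pdx Θ x t ^ 2) + ∫ x in a..b, 2 * Θ x t * pdt Θ x t ≤
      2 * heatRate (b - a) M K * ∫ x in a..b, Θ x t ^ 2 := by
  have hΘ := (hs.spaceC1_Θ (k := 0) (by norm_num)).hasDerivAt t ht.le
  have cΘ₁ := continuousOn_slice (hs.cont_Θ 1 (by norm_num)) ht.le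
  have h1 := hs.integral_mul_pdt_Θ hab hf ht hΘ cΘ₁
  have h2 := heat_flux_le hab hf hΘ cΘ₁ (fun x hx => hs.Θ_pos x hx t ht.le)
    (continuousOn_slice hs.timeC1_v.cont ht.le)
    (continuousOn_slice (hs.spaceC1_f_Θ hf).cont ht.le)
    (continuousOn_slice (hs.cont_deriv_f_Θ hf) ht.le) hK
  have h3 : ∫ x in a..b, 2 * Θ x t * pdt Θ x t = 2 * ∫ x in a..b, Θ x t * pdt Θ x t := by
    rw [← intervalIntegral.integral_const_mul]
    exact integral_eq_of_eqOn_Icc hab.le fun x _ => by ring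
  have h4 : ∫ x in a..b, pdx Θ x t * pdx Θ x t = ∫ x in a..b, pdx Θ x t ^ 2 := by
    simp only [sq]
  change ∫ x in a..b, Θ x t * pdt Θ x t = -(∫ x in a..b, pdx Θ x t * pdx Θ x t)
      + ∫ x in a..b, (pdx Θ x t * f (Θ x t) + Θ x t * (f' (Θ x t) * pdx Θ x t)) * v x t at h1
  change ∫ x in a..b, (pdx Θ x t * f (Θ x t) + Θ x t * (f' (Θ x t) * pdx Θ x t)) * v x t ≤
    1 / 2 * (∫ x in a..b, pdx Θ x t ^ 2)
      + heatRate (b - a) M K * ∫ x in a..b, Θ x t ^ 2 at h2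
  rw [h3, h1, h4]
  linarith

theorem temperature_sq_le (hs : IsClassicalSolEps a b f ε v0 u0 Θ0 v u Θ) (hab : a < b)
    (hf : LipschitzNonlinearity f f' M) {K t : ℝ} (ht : 0 ≤ t)
    (hK : ∀ t, 0 ≤ t → ∫ x in a..b, v x t ^ 2 ≤ K) :
    ∫ x in a..b, Θ x t ^ 2 ≤
      (∫ x in a..b, Θ x 0 ^ 2) * Real.exp (2 * heatRate (b - a) M K * t) := by
  have key := le_mul_exp_of_hasDerivAt_le (y := fun t => ∫ x in a..b, Θ x t ^ 2)
    (B := fun t => 2 * heatRate (b - a) M K * t) (B' := fun _ => 2 * heatRate (b - a) M K) ht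
    (continuousOn_integral_sq hab.le hs.timeC1_Θ.cont) (by fun_prop)
    (fun s _ => by simpa using (hasDerivAt_id s).const_mul (2 * heatRate (b - a) M K))
    (fun s hs0 _ => ⟨_, hs.timeC1_Θ.sq.hasDerivAt_integral hab.le hs0, ?_⟩)
  · simpa using key
  · linarith [hs.temperature_energy hab hf hs0 (hK s hs0.le),
      integral_sq_nonneg hab.le fun x => pdx Θ x s]

theorem difference_energy (hs : IsClassicalSolEps a b f ε v0 u0 Θ0 v u Θ) (hab : a < b)
    (hε : 0 ≤ ε) (hf : LipschitzNonlinearity f f' M) {K K₂ h t : ℝ} (hh : 0 ≤ h) (ht : 0 < t)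
    (hK : ∫ x in a..b, v x t ^ 2 ≤ K) (hK₂ : ∫ x in a..b, Θ x (t + h) ^ 2 ≤ K₂) :
    ∃ d, HasDerivAt (fun s => (∫ x in a..b, timeDiff h v x s ^ 2)
        + (∫ x in a..b, timeDiff h (pdx u) x s ^ 2)
        + ∫ x in a..b, timeDiff h Θ x s ^ 2) d t ∧
      d ≤ 2 * differenceRate (b - a) M K K₂
          * (1 + (∫ x in a..b, pdx Θ x t ^ 2) + ∫ x in a..b, pdx Θ x (t + h) ^ 2)
          * ((∫ x in a..b, timeDiff h v x t ^ 2) + (∫ x in a..b, timeDiff h (pdx u) x t ^ 2)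
            + ∫ x in a..b, timeDiff h Θ x t ^ 2) := by
  have hth : 0 < t + h := by linarith
  have hshift : ∀ {t}, 0 < t → 0 < t + h := fun ht => by linarith
  obtain ⟨d, hd, hle⟩ := mechanical_energy hab.le hε (hs.timeC1_v.timeDiff hh)
    ((hs.spaceC1_v (k := 0) (by norm_num)).timeDiff hh)
    ((hs.spaceC1_v (k := 1) (by norm_num)).timeDiff hh)
    ((hs.spaceC1_v (k := 2) (by norm_num)).timeDiff hh)
    ((hs.spaceC1_v (k := 3) (by norm_num)).timeDiff hh) (hs.timeC1_u.timeDiff hh)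
    ((hs.spaceC1_u (k := 0) (by norm_num)).timeDiff hh)
    ((hs.spaceC1_u (k := 1) (by norm_num)).timeDiff hh)
    (G := timeDiff h fun x t => f' (Θ x t) * pdx Θ x t)
    (fun t ht => by
      obtain ⟨h1, h2, h3, h4⟩ := hs.bc_v t ht
      obtain ⟨k1, k2, k3, k4⟩ := hs.bc_v (t + h) (hshift ht)
      simp only [timeDiff, h1, h2, h3, h4, k1, k2, k3, k4, sub_self, and_self])
    (fun t ht => by
      obtain ⟨h1, h2⟩ := hs.bc_u t ht
      obtain ⟨k1, k2⟩ := hs.bc_u (t + h) (hshift ht)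
      simp only [timeDiff, h1, h2, k1, k2, sub_self, and_self])
    (fun t ht x hx => by
      simp only [timeDiff]
      rw [hs.eq_v_Icc hab hf ht x hx, hs.eq_v_Icc hab hf (hshift ht) x hx]
      ring)
    (fun t ht x hx => by
      simp only [timeDiff]
      rw [hs.eq_u_Icc hab ht x hx, hs.eq_u_Icc hab (hshift ht) x hx]
      ring)
    (continuousOn_timeDiff hh (hs.spaceC1_f_Θ hf).cont_deriv) ht
  refine ⟨_, hd.add ((hs.timeC1_Θ.timeDiff hh).sq.hasDerivAt_integral hab.le ht), ?_⟩
  have hΘ := (hs.spaceC1_Θ (k := 0) (by norm_num)).hasDerivAt t ht.le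
  have hΘh := (hs.spaceC1_Θ (k := 0) (by norm_num)).hasDerivAt (t + h) hth.le
  have hθ := ((hs.spaceC1_Θ (k := 0) (by norm_num)).timeDiff hh).hasDerivAt t ht.le
  have cv := continuousOn_slice hs.timeC1_v.cont ht.le
  have cvh := continuousOn_slice hs.timeC1_v.cont hth.le
  have cΘ := continuousOn_slice hs.timeC1_Θ.cont ht.le
  have cΘh := continuousOn_slice hs.timeC1_Θ.cont hth.le
  have cΘ₁ : ContinuousOn (fun x => pdx Θ x t) (Icc a b) :=
    continuousOn_slice (hs.cont_Θ 1 (by norm_num)) ht.le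
  have cΘh₁ : ContinuousOn (fun x => pdx Θ x (t + h)) (Icc a b) :=
    continuousOn_slice (hs.cont_Θ 1 (by norm_num)) hth.le
  have cF := continuousOn_slice (hs.spaceC1_f_Θ hf).cont ht.le
  have cFh := continuousOn_slice (hs.spaceC1_f_Θ hf).cont hth.le
  have cf' := continuousOn_slice (hs.cont_deriv_f_Θ hf) ht.le
  have cfh' := continuousOn_slice (hs.cont_deriv_f_Θ hf) hth.le
  have cΘt := continuousOn_slice hs.contt_Θ ht.le
  have cΘth := continuousOn_slice hs.contt_Θ hth.le
  have hflux := difference_flux_le hab hf hΘ cΘ₁ hΘh cΘh₁ (fun x hx => hs.Θ_pos x hx t ht.le)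
    (fun x hx => hs.Θ_pos x hx (t + h) hth.le) cv cvh cF cf' cFh cfh' hK hK₂
  have h1 := hs.integral_mul_pdt_Θ hab hf ht hθ (cΘh₁.sub cΘ₁)
  have h1h := hs.integral_mul_pdt_Θ hab hf hth hθ (cΘh₁.sub cΘ₁)
  simp only [timeDiff, zero_add, iterate_one, iterate_zero, id] at h1 h1h hflux hle ⊢
  set D := ∫ x in a..b, (pdx Θ x (t + h) - pdx Θ x t) ^ 2 with hD
  set N := ∫ x in a..b, ((pdx Θ x (t + h) - pdx Θ x t) * f (Θ x t)
    + (Θ x (t + h) - Θ x t) * (f' (Θ x t) * pdx Θ x t)) * v x t with hN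
  set Nh := ∫ x in a..b, ((pdx Θ x (t + h) - pdx Θ x t) * f (Θ x (t + h))
    + (Θ x (t + h) - Θ x t) * (f' (Θ x (t + h)) * pdx Θ x (t + h))) * v x (t + h) with hNh
  set Q := ∫ x in a..b, -((v x (t + h) - v x t)
    * (f' (Θ x (t + h)) * pdx Θ x (t + h) - f' (Θ x t) * pdx Θ x t)) with hQ
  have cdiff : ContinuousOn (fun x => Θ x (t + h) - Θ x t) (Icc a b) := cΘh.sub cΘ
  have cdiff₁ : ContinuousOn (fun x => pdx Θ x (t + h) - pdx Θ x t) (Icc a b) := cΘh₁.sub cΘ₁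
  have hDsplit : (∫ x in a..b, (pdx Θ x (t + h) - pdx Θ x t) * pdx Θ x (t + h))
      - (∫ x in a..b, (pdx Θ x (t + h) - pdx Θ x t) * pdx Θ x t) = D := by
    rw [hD, ← intervalIntegral.integral_sub
      ((cdiff₁.fun_mul cΘh₁).intervalIntegrable_of_Icc hab.le)
      ((cdiff₁.fun_mul cΘ₁).intervalIntegrable_of_Icc hab.le)]
    exact integral_eq_of_eqOn_Icc hab.le fun x _ => by ring
  have htime : ∫ x in a..b, 2 * (Θ x (t + h) - Θ x t) * (pdt Θ x (t + h) - pdt Θ x t) =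
      2 * ((∫ x in a..b, (Θ x (t + h) - Θ x t) * pdt Θ x (t + h))
        - ∫ x in a..b, (Θ x (t + h) - Θ x t) * pdt Θ x t) := by
    rw [← intervalIntegral.integral_sub ((cdiff.fun_mul cΘth).intervalIntegrable_of_Icc hab.le)
      ((cdiff.fun_mul cΘt).intervalIntegrable_of_Icc hab.le), ← intervalIntegral.integral_const_mul]
    exact integral_eq_of_eqOn_Icc hab.le fun x _ => by ring
  have hsum : Q + Nh - N = ∫ x in a..b, (-((v x (t + h) - v x t)
        * (f' (Θ x (t + h)) * pdx Θ x (t + h) - f' (Θ x t) * pdx Θ x t))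
      + (pdx Θ x (t + h) - pdx Θ x t) * (f (Θ x (t + h)) * v x (t + h) - f (Θ x t) * v x t)
      + (Θ x (t + h) - Θ x t) * (f' (Θ x (t + h)) * pdx Θ x (t + h) * v x (t + h)
        - f' (Θ x t) * pdx Θ x t * v x t)) := by
    have iQ := (((cvh.sub cv).mul ((cfh'.mul cΘh₁).sub
      (cf'.mul cΘ₁))).neg).intervalIntegrable_of_Icc hab.le (μ := volume)
    have iNh := (((cdiff₁.mul cFh).add (cdiff.mul (cfh'.mul cΘh₁))).mul
      cvh).intervalIntegrable_of_Icc hab.le (μ := volume)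
    have iN := (((cdiff₁.mul cF).add (cdiff.mul (cf'.mul cΘ₁))).mul
      cv).intervalIntegrable_of_Icc hab.le (μ := volume)
    refine ((congrArg (· - N) (intervalIntegral.integral_add iQ iNh).symm).trans
      (intervalIntegral.integral_sub (iQ.add iNh) iN).symm).trans ?_
    refine integral_eq_of_eqOn_Icc hab.le fun x _ => ?_
    simp only [Pi.add_apply, Pi.mul_apply, Pi.sub_apply, Pi.neg_apply]
    ring
  rw [← hsum] at hflux
  rw [htime, h1, h1h]
  have hrate := differenceRate_nonneg (M := M) (K := K) (K₂ := K₂) (sub_pos.2 hab) hf.nonneg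
    ((integral_sq_nonneg hab.le _).trans hK) ((integral_sq_nonneg hab.le _).trans hK₂)
  have hP := integral_sq_nonneg hab.le fun x => pdx Θ x t
  have hPh := integral_sq_nonneg hab.le fun x => pdx Θ x (t + h)
  have hD0 : 0 ≤ D := integral_sq_nonneg hab.le _
  have hZ := integral_sq_nonneg hab.le fun x => pdx u x (t + h) - pdx u x t
  have hextra : 0 ≤ differenceRate (b - a) M K K₂
      * (1 + (∫ x in a..b, pdx Θ x t ^ 2) + ∫ x in a..b, pdx Θ x (t + h) ^ 2)
      * ∫ x in a..b, (pdx u x (t + h) - pdx u x t) ^ 2 := by positivity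
  linarith

theorem difference_le (hs : IsClassicalSolEps a b f ε v0 u0 Θ0 v u Θ) (hab : a < b)
    (hε : 0 ≤ ε) (hf : LipschitzNonlinearity f f' M) {K K₂ T h t : ℝ} (hh : h ∈ Ioo (0 : ℝ) 1)
    (ht : t ∈ Ioo 0 T) (hK : ∀ t, 0 ≤ t → ∫ x in a..b, v x t ^ 2 ≤ K)
    (hK₂ : ∀ t, 0 ≤ t → t ≤ T + 1 → ∫ x in a..b, Θ x t ^ 2 ≤ K₂) :
    (∫ x in a..b, timeDiff h v x t ^ 2) + (∫ x in a..b, timeDiff h (pdx u) x t ^ 2)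
        + (∫ x in a..b, timeDiff h Θ x t ^ 2) ≤
      ((∫ x in a..b, timeDiff h v x 0 ^ 2) + (∫ x in a..b, timeDiff h (pdx u) x 0 ^ 2)
        + (∫ x in a..b, timeDiff h Θ x 0 ^ 2))
        * Real.exp (2 * differenceRate (b - a) M K K₂
          * ((1 + 4 * heatRate (b - a) M K * K₂) * T + 2 * K₂)) := by
  obtain ⟨ht0, htT⟩ := ht
  obtain ⟨hh0, hh1⟩ := hh
  have hK0 : 0 ≤ K := (integral_sq_nonneg hab.le _).trans (hK 0 le_rfl)
  have hK₂0 : 0 ≤ K₂ := (integral_sq_nonneg hab.le _).trans (hK₂ 0 le_rfl (by linarith))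
  have hdr := differenceRate_nonneg (M := M) (K := K) (K₂ := K₂) (sub_pos.2 hab) hf.nonneg
    hK0 hK₂0
  have hhr := heatRate_nonneg (M := M) (sub_pos.2 hab) hK0
  set A := differenceRate (b - a) M K K₂
  set H := heatRate (b - a) M K
  set E : ℝ → ℝ := fun t => ∫ x in a..b, Θ x t ^ 2 with hE
  have cE : ContinuousOn E (Ici 0) :=
    continuousOn_integral_sq hab.le hs.timeC1_Θ.cont
  have cEh : ContinuousOn (fun t => E (t + h)) (Ici 0) :=
    cE.comp (by fun_prop) fun s hs => add_nonneg hs hh0.le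
  have hE' : ∀ s, 0 < s → HasDerivAt E (∫ x in a..b, 2 * Θ x s * pdt Θ x s) s := fun s hs0 =>
    hs.timeC1_Θ.sq.hasDerivAt_integral hab.le hs0
  have hEnn : ∀ s, 0 ≤ E s := fun s => integral_sq_nonneg hab.le _
  have key := le_mul_exp_of_hasDerivAt_le
    (y := fun t => (∫ x in a..b, timeDiff h v x t ^ 2)
      + (∫ x in a..b, timeDiff h (pdx u) x t ^ 2) + (∫ x in a..b, timeDiff h Θ x t ^ 2))
    (B := fun s => 2 * A * ((1 + 4 * H * K₂) * s - E s - E (s + h)))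
    (B' := fun s => 2 * A * ((1 + 4 * H * K₂) - (∫ x in a..b, 2 * Θ x s * pdt Θ x s)
      - ∫ x in a..b, 2 * Θ x (s + h) * pdt Θ x (s + h))) ht0.le
    (((continuousOn_integral_sq hab.le
      (continuousOn_timeDiff hh0.le hs.timeC1_v.cont)).add
      (continuousOn_integral_sq hab.le
        (continuousOn_timeDiff hh0.le (hs.cont_u 1 (by norm_num))))).add
      (continuousOn_integral_sq hab.le (continuousOn_timeDiff hh0.le hs.timeC1_Θ.cont)))
    (continuousOn_const.mul (((continuousOn_const.mul continuousOn_id).sub cE).sub cEh)) (fun s hs0 => ?_) (fun s hs0 hst => ?_)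
  · refine key.trans (mul_le_mul_of_nonneg_left (Real.exp_le_exp.2 ?_) ?_)
    · have h1 := hK₂ 0 le_rfl (by linarith)
      have h2 := hK₂ h hh0.le (by linarith)
      have h3 : (1 + 4 * H * K₂) * t ≤ (1 + 4 * H * K₂) * T := by gcongr
      rw [← mul_sub]
      refine mul_le_mul_of_nonneg_left ?_ (by positivity)
      have h4 : E 0 ≤ K₂ := h1
      have h5 : E h ≤ K₂ := h2
      rw [zero_add]
      linarith [hEnn t, hEnn (t + h)]
    · have h1 := integral_sq_nonneg hab.le fun x => timeDiff h v x 0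
      have h2 := integral_sq_nonneg hab.le fun x => timeDiff h (pdx u) x 0
      have h3 := integral_sq_nonneg hab.le fun x => timeDiff h Θ x 0
      linarith
  · have hlin : HasDerivAt (fun s => (1 + 4 * H * K₂) * s) (1 + 4 * H * K₂) s := by
      simpa using (hasDerivAt_id s).const_mul (1 + 4 * H * K₂)
    exact ((hlin.sub (hE' s hs0)).sub
      ((hE' (s + h) (by linarith)).comp_add_const s h)).const_mul (2 * A)
  · have hsh : 0 < s + h := by linarith
    obtain ⟨d, hd, hle⟩ := hs.difference_energy hab hε hf hh0.le hs0 (hK s hs0.le)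
      (hK₂ (s + h) hsh.le (by linarith))
    refine ⟨d, hd, hle.trans (mul_le_mul_of_nonneg_right
      (mul_le_mul_of_nonneg_left ?_ (by positivity)) ?_)⟩
    · have h1 := hs.temperature_energy hab hf hs0 (hK s hs0.le)
      have h2 := hs.temperature_energy hab hf hsh (hK (s + h) hsh.le)
      have h3 := mul_le_mul_of_nonneg_left (hK₂ s hs0.le (by linarith))
        (show 0 ≤ 2 * H by positivity)
      have h4 := mul_le_mul_of_nonneg_left (hK₂ (s + h) hsh.le (by linarith))
        (show 0 ≤ 2 * H by positivity)
      linarith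
    · have h1 := integral_sq_nonneg hab.le fun x => timeDiff h v x s
      have h2 := integral_sq_nonneg hab.le fun x => timeDiff h (pdx u) x s
      have h3 := integral_sq_nonneg hab.le fun x => timeDiff h Θ x s
      linarith

theorem pdx_u_zero (hs : IsClassicalSolEps a b f ε v0 u0 Θ0 v u Θ) {x : ℝ}
    (hx : x ∈ Ioo a b) : pdx u x 0 = deriv u0 x := by
  refine EventuallyEq.deriv_eq ?_
  filter_upwards [Ioo_mem_nhds hx.1 hx.2] with y hy
  exact (hs.init y (Ioo_subset_Icc_self hy)).2.1

end IsClassicalSolEps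

/-- Lemma 4.7: ε-independent estimate of time-shift differences. -/
theorem statement16
    (a b : ℝ) (hab : a < b)
    (f f' f'' : ℝ → ℝ) (hf : HypF f f' f'')
    (v0 u0 Θ0 : ℝ → ℝ) (hdata : SmoothData a b v0 u0 Θ0)
    (T : ℝ) (hT : 0 < T)
    (v u Θ : ℝ → ℝ → ℝ → ℝ)
    (hsol : ∀ ε ∈ Ioo (0 : ℝ) 1, IsClassicalSolEps a b f ε v0 u0 Θ0 (v ε) (u ε) (Θ ε)) :
    ∃ C > (0 : ℝ), ∀ ε ∈ Ioo (0 : ℝ) 1, ∀ h ∈ Ioo (0 : ℝ) 1, ∀ t ∈ Ioo 0 T,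
      (∫ x in Ioo a b, (v ε x (t + h) - v ε x t) ^ 2)
          + (∫ x in Ioo a b, (pdx (u ε) x (t + h) - pdx (u ε) x t) ^ 2)
          + (∫ x in Ioo a b, (Θ ε x (t + h) - Θ ε x t) ^ 2)
        ≤ C * ((∫ x in Ioo a b, (v ε x h - v0 x) ^ 2)
            + (∫ x in Ioo a b, (pdx (u ε) x h - deriv u0 x) ^ 2)
            + ∫ x in Ioo a b, (Θ ε x h - Θ0 x) ^ 2) := by
  obtain ⟨M, hf'⟩ := hf.exists_lipschitzNonlinearity
  have toIoo := fun g : ℝ → ℝ => intervalIntegral_eq_integral_Ioo hab.le g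
  set K : ℝ := (∫ x in Ioo a b, v0 x ^ 2) + (∫ x in Ioo a b, deriv u0 x ^ 2)
    + 2 * ∫ x in Ioo a b, Θ0 x with hKdef
  set H := IsClassicalSolEps.heatRate (b - a) M K with hH
  set K₂ : ℝ := (∫ x in Ioo a b, Θ0 x ^ 2) * Real.exp (2 * H * (T + 1)) with hK₂def
  refine ⟨_, Real.exp_pos (2 * differenceRate (b - a) M K K₂
    * ((1 + 4 * H * K₂) * T + 2 * K₂)), fun ε hε h hh t ht => ?_⟩
  have hs := hsol ε hε
  have init := fun x (hx : x ∈ Ioo a b) => hs.init x (Ioo_subset_Icc_self hx)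
  have hK : ∀ t, 0 ≤ t → ∫ x in a..b, v ε x t ^ 2 ≤ K := by
    intro t ht
    have h1 := hs.energy_le hab hε.1.le hf' ht
    have h2 := integral_sq_nonneg hab.le fun x => pdx (u ε) x t
    have h3 : 0 ≤ ∫ x in a..b, Θ ε x t :=
      intervalIntegral.integral_nonneg hab.le fun x hx => (hs.Θ_pos x hx t ht).le
    have e1 : ∫ x in a..b, v ε x 0 ^ 2 = ∫ x in Ioo a b, v0 x ^ 2 := by
      rw [toIoo]
      exact setIntegral_congr_fun measurableSet_Ioo fun x hx => by simp only [(init x hx).1]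
    have e2 : ∫ x in a..b, pdx (u ε) x 0 ^ 2 = ∫ x in Ioo a b, deriv u0 x ^ 2 := by
      rw [toIoo]
      exact setIntegral_congr_fun measurableSet_Ioo fun x hx => by simp only [hs.pdx_u_zero hx]
    have e3 : ∫ x in a..b, Θ ε x 0 = ∫ x in Ioo a b, Θ0 x := by
      rw [toIoo]
      exact setIntegral_congr_fun measurableSet_Ioo fun x hx => (init x hx).2.2
    rw [e1, e2, e3] at h1
    linarith
  have hK0 : 0 ≤ K := (integral_sq_nonneg hab.le _).trans (hK 0 le_rfl)
  have hH0 : 0 ≤ H := IsClassicalSolEps.heatRate_nonneg (sub_pos.2 hab) hK0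
  have hK₂ : ∀ t, 0 ≤ t → t ≤ T + 1 → ∫ x in a..b, Θ ε x t ^ 2 ≤ K₂ := by
    intro t ht htT
    refine (hs.temperature_sq_le hab hf' ht hK).trans ?_
    have e1 : ∫ x in a..b, Θ ε x 0 ^ 2 = ∫ x in Ioo a b, Θ0 x ^ 2 := by
      rw [toIoo]
      exact setIntegral_congr_fun measurableSet_Ioo fun x hx => by simp only [(init x hx).2.2]
    have h0 : 0 ≤ ∫ x in Ioo a b, Θ0 x ^ 2 := integral_nonneg fun x => sq_nonneg _
    rw [e1, hK₂def]
    gcongr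
  have key := hs.difference_le hab hε.1.le hf' hh ht hK hK₂
  simp only [toIoo, timeDiff, zero_add] at key
  have e1 : ∫ x in Ioo a b, (v ε x h - v ε x 0) ^ 2 = ∫ x in Ioo a b, (v ε x h - v0 x) ^ 2 :=
    setIntegral_congr_fun measurableSet_Ioo fun x hx => by simp only [(init x hx).1]
  have e2 : ∫ x in Ioo a b, (pdx (u ε) x h - pdx (u ε) x 0) ^ 2 =
      ∫ x in Ioo a b, (pdx (u ε) x h - deriv u0 x) ^ 2 :=
    setIntegral_congr_fun measurableSet_Ioo fun x hx => by simp only [hs.pdx_u_zero hx]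
  have e3 : ∫ x in Ioo a b, (Θ ε x h - Θ ε x 0) ^ 2 = ∫ x in Ioo a b, (Θ ε x h - Θ0 x) ^ 2 :=
    setIntegral_congr_fun measurableSet_Ioo fun x hx => by simp only [(init x hx).2.2]
  rw [e1, e2, e3, mul_comm] at key
  exact key
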